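/- (Multiple Sears transformation, Proposition 6.8 of the paper) For all compositions u, w ∈ ℕ^n, Σ_v ((aq/b, aq/c)_u (d, e)_v / ((aq/b, aq/c)_v (d, e)_w)) ⟦u, v⟧(1, aq/de) ⟦v, w⟧(aq/de, a²q²/bcde) = Σ_v ((aq/b, aq/d)_u (c, e)_v / ((aq/b, aq/d)_v (c, e)_w)) ⟦u, v⟧(1, aq/ce) ⟦v, w⟧(aq/ce, a²q²/bcde), both sums over all compositions v ∈ ℕ^n (finitely supported on |w| ≤ |v| ≤ |u|). -/

import Mathlib

open scoped BigOperators
open MvPolynomial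

noncomputable section
namespace LRW

variable {n : ℕ}

/-- `|u|`, the weight of a composition `u ∈ ℕⁿ`. -/
def wt (u : Fin n → ℕ) : ℕ := ∑ i, u i

/-- `l'_u(i) = #{k > i : u_k > u_i} + #{k < i : u_k ≥ u_i}`. -/
def lp (u : Fin n → ℕ) (i : Fin n) : ℕ :=
  (Finset.univ.filter fun k => i < k ∧ u i < u k).card +
  (Finset.univ.filter fun k => k < i ∧ u i ≤ u k).card

/-- The spectral vector `⟨u⟩ : ⟨u⟩_i = q^{u_i} t^{n−1−l'_u(i)}`. -/
def spec (q t : ℂ) (u : Fin n → ℕ) : Fin n → ℂ :=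
  fun i => q ^ u i * t ^ (n - 1 - lp u i)

/-- Leg length `l(s)` of the cell `s = (i, j+1)` of `u` (so `j` ranges over
`0, …, u_i − 1`): `l(s) = #{k > i : j+1 ≤ u_k ≤ u_i} + #{k < i : j+1 ≤ u_k + 1 ≤ u_i}`. -/
def leg (u : Fin n → ℕ) (i : Fin n) (j : ℕ) : ℕ :=
  (Finset.univ.filter fun k => i < k ∧ j < u k ∧ u k ≤ u i).card +
  (Finset.univ.filter fun k => k < i ∧ j ≤ u k ∧ u k < u i).card

/-- `n(u) = Σ_{s ∈ u} l(s)`. -/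
def nstat (u : Fin n → ℕ) : ℕ := ∑ i, ∑ j ∈ Finset.range (u i), leg u i j

/-- `n'(u) = Σ_i C(u_i, 2)`. -/
def nstat' (u : Fin n → ℕ) : ℕ := ∑ i, Nat.choose (u i) 2

/-- `n(u⁺) = Σ_{i<j} min(u_i, u_j)`, the statistic `n` of the decreasing
rearrangement of `u`. -/
def nplus (u : Fin n → ℕ) : ℕ := ∑ i, ∑ j, if i < j then min (u i) (u j) else 0

/-- `τ_u = (−1)^{|u|} q^{n'(u)} t^{−n(u⁺)}`. -/
def tau (q t : ℂ) (u : Fin n → ℕ) : ℂ := (-1) ^ wt u * q ^ nstat' u / t ^ nplus u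

/-- The generalized q-shifted factorial `(z)_u = ∏_{s ∈ u} (1 − z q^{a'(s)} t^{−l'(s)})`. -/
def qfac (q t z : ℂ) (u : Fin n → ℕ) : ℂ :=
  ∏ i, ∏ j ∈ Finset.range (u i), (1 - z * q ^ j / t ^ lp u i)

/-- `c'_u = ∏_{s ∈ u} (1 − q^{a(s)+1} t^{l(s)})`. -/
def cp (q t : ℂ) (u : Fin n → ℕ) : ℂ :=
  ∏ i, ∏ j ∈ Finset.range (u i), (1 - q ^ (u i - j) * t ^ leg u i j)

/-- `M` is a family of interpolation Macdonald polynomials: `M u` has total degree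
at most `|u|`, the coefficient of `x^u` in `M u` is `q^{−n'(u)}`, and `M u`
vanishes at `⟨v⟩` for every `v` with `|v| ≤ |u|`, `v ≠ u`. -/
def IsInterpFamily (q t : ℂ) (M : (Fin n → ℕ) → MvPolynomial (Fin n) ℂ) : Prop :=
  ∀ u, (M u).totalDegree ≤ wt u ∧
    coeff (Finsupp.equivFunOnFinite.symm u) (M u) = (q ^ nstat' u)⁻¹ ∧
    ∀ v, wt v ≤ wt u → v ≠ u → eval (spec q t v) (M u) = 0

/-- `𝖬_u = q^{n'(u)} t^{n(u)} M_u / c'_u`. -/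
def MM (q t : ℂ) (M : (Fin n → ℕ) → MvPolynomial (Fin n) ℂ) (u : Fin n → ℕ) :
    MvPolynomial (Fin n) ℂ :=
  C (q ^ nstat' u * t ^ nstat u / cp q t u) * M u

/-- `𝖤_u = t^{n(u)} E_u / c'_u`, where `E_u` is the homogeneous component of
degree `|u|` of `M_u`. -/
def EE (q t : ℂ) (M : (Fin n → ℕ) → MvPolynomial (Fin n) ℂ) (u : Fin n → ℕ) :
    MvPolynomial (Fin n) ℂ :=
  C (t ^ nstat u / cp q t u) * homogeneousComponent (wt u) (M u)

/-- The generalized q-binomial coefficient `[u; v] = 𝖬_v(⟨u⟩)/𝖬_v(⟨v⟩)`. -/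
def qbin (q t : ℂ) (M : (Fin n → ℕ) → MvPolynomial (Fin n) ℂ) (u v : Fin n → ℕ) : ℂ :=
  eval (spec q t u) (MM q t M v) / eval (spec q t v) (MM q t M v)

/-- `⟨0⟩/a = (t^{n−1}/a, …, t/a, 1/a)`. -/
def spec0div (q t a : ℂ) : Fin n → ℂ := fun i => spec q t (fun _ => 0) i / a

/-- `cc` is the family of connection coefficients `c_{uv}(a,b)`:
`cc u v = 0` unless `|v| ≤ |u|`, and `𝖬_u(a·x) = Σ_v cc u v · 𝖬_v(b·x)`. -/
def IsConnection (q t : ℂ) (M : (Fin n → ℕ) → MvPolynomial (Fin n) ℂ) (a b : ℂ)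
    (cc : (Fin n → ℕ) → (Fin n → ℕ) → ℂ) : Prop :=
  (∀ u v, wt u < wt v → cc u v = 0) ∧
  ∀ u, aeval (fun i => C a * X i) (MM q t M u) =
    ∑ᶠ v, cc u v • aeval (fun i => C b * X i) (MM q t M v)

/-- `⟦u, v⟧(a, b) = (𝖤_v(⟨0⟩/a)/𝖤_u(⟨0⟩/b)) · c_{uv}(a, b)`. -/
def skew (q t : ℂ) (M : (Fin n → ℕ) → MvPolynomial (Fin n) ℂ) (a b : ℂ)
    (cc : (Fin n → ℕ) → (Fin n → ℕ) → ℂ) (u v : Fin n → ℕ) : ℂ :=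
  eval (spec0div q t a) (EE q t M v) / eval (spec0div q t b) (EE q t M u) * cc u v

/-- `(z; q)_∞ = ∏_{m ≥ 0} (1 − z q^m)`. -/
noncomputable def qpochInf (z q : ℂ) : ℂ := ∏' m : ℕ, (1 - z * q ^ m)

section

/-! ### Polynomial functions of bounded degree -/

/-- The polynomial functions on `ℂⁿ` of degree less than `k`. -/
def Pol (n k : ℕ) : Submodule ℂ ((Fin n → ℂ) → ℂ) where
  carrier := {f | ∃ p : MvPolynomial (Fin n) ℂ, (∀ m ∈ p.support, m.degree < k) ∧
    ∀ x, eval x p = f x}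
  add_mem' := by
    rintro f g ⟨p, hp, hpf⟩ ⟨r, hr, hrg⟩
    refine ⟨p + r, fun m hm => ?_, fun x => by simp [hpf, hrg]⟩
    rcases Finset.mem_union.1 (support_add hm) with h | h
    exacts [hp m h, hr m h]
  zero_mem' := ⟨0, by simp, by simp⟩
  smul_mem' := by
    rintro a f ⟨p, hp, hpf⟩
    exact ⟨a • p, fun m hm => hp m (support_smul hm), fun x => by simp [hpf, smul_eval]⟩

theorem mem_Pol {k : ℕ} {f : (Fin n → ℂ) → ℂ} :
    f ∈ Pol n k ↔ ∃ p : MvPolynomial (Fin n) ℂ, (∀ m ∈ p.support, m.degree < k) ∧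
      ∀ x, eval x p = f x := Iff.rfl

theorem mem_Pol_succ {k : ℕ} {f : (Fin n → ℂ) → ℂ} :
    f ∈ Pol n (k + 1) ↔ ∃ p : MvPolynomial (Fin n) ℂ, p.totalDegree ≤ k ∧
      ∀ x, eval x p = f x := by
  have key : ∀ p : MvPolynomial (Fin n) ℂ,
      (∀ m ∈ p.support, m.degree < k + 1) ↔ p.totalDegree ≤ k := by
    intro p
    simp only [Nat.lt_succ_iff, totalDegree, Finset.sup_le_iff]
    rfl
  simp only [mem_Pol, key]

theorem eval_mem_Pol {k : ℕ} {p : MvPolynomial (Fin n) ℂ} (h : p.totalDegree ≤ k) :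
    (fun x => eval x p) ∈ Pol n (k + 1) := mem_Pol_succ.2 ⟨p, h, fun _ => rfl⟩

theorem Pol_mono {k l : ℕ} (h : k ≤ l) : Pol n k ≤ Pol n l := by
  rintro f ⟨p, hp, hpf⟩
  exact ⟨p, fun m hm => (hp m hm).trans_le h, hpf⟩

theorem eq_zero_of_mem_Pol_zero {f : (Fin n → ℂ) → ℂ} (h : f ∈ Pol n 0) : f = 0 := by
  obtain ⟨p, hp, hpf⟩ := h
  have : p = 0 := by
    rw [← support_eq_empty, Finset.eq_empty_iff_forall_notMem]
    exact fun m hm => absurd (hp m hm) (by simp)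
  funext x
  simp [← hpf, this]

theorem mul_mem_Pol {k l : ℕ} {f g : (Fin n → ℂ) → ℂ} (hf : f ∈ Pol n (k + 1))
    (hg : g ∈ Pol n (l + 1)) : (fun x => f x * g x) ∈ Pol n (k + l + 1) := by
  obtain ⟨p, hp, hpf⟩ := mem_Pol_succ.1 hf
  obtain ⟨r, hr, hrg⟩ := mem_Pol_succ.1 hg
  exact mem_Pol_succ.2 ⟨p * r, (totalDegree_mul _ _).trans (add_le_add hp hr),
    fun x => by simp [hpf, hrg]⟩

theorem const_mem_Pol (k : ℕ) (a : ℂ) : (fun _ => a) ∈ Pol n (k + 1) :=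
  mem_Pol_succ.2 ⟨C a, by simp, by simp⟩

theorem coord_mem_Pol (k : ℕ) (i : Fin n) : (fun x => x i) ∈ Pol n (k + 2) :=
  mem_Pol_succ.2 ⟨X i, by simp, by simp⟩

theorem affine_mem_Pol (a b : ℂ) (i : Fin n) : (fun x => a * x i + b) ∈ Pol n 2 :=
  (Pol n 2).add_mem ((Pol n 2).smul_mem a (coord_mem_Pol 0 i)) (const_mem_Pol 1 b)

theorem scale_mem_Pol (a : ℂ) (i : Fin n) : (fun x => a * x i) ∈ Pol n 2 :=
  (Pol n 2).smul_mem a (coord_mem_Pol 0 i)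

theorem comp_mem_Pol {n' k : ℕ} {f : (Fin n → ℂ) → ℂ} (hf : f ∈ Pol n k)
    {g : Fin n → (Fin n' → ℂ) → ℂ} (hg : ∀ i, g i ∈ Pol n' 2) :
    (fun x => f (fun i => g i x)) ∈ Pol n' k := by
  obtain ⟨p, hp, hpf⟩ := hf
  choose G hG hGg using fun i => mem_Pol_succ.1 (hg i)
  have : (fun x => f (fun i => g i x)) =
      ∑ m ∈ p.support, coeff m p • fun x => ∏ i, g i x ^ m i := by
    funext x
    simp [← hpf, eval_eq', Finset.sum_apply]
  rw [this]
  refine Submodule.sum_mem _ fun m hm => Submodule.smul_mem _ _ (Pol_mono (hp m hm) ?_)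
  refine mem_Pol_succ.2 ⟨∏ i, G i ^ m i, ?_, fun x => by simp [hGg]⟩
  refine (totalDegree_finsetProd _ _).trans ?_
  rw [Finsupp.degree_eq_sum]
  refine Finset.sum_le_sum fun i _ => (totalDegree_pow _ _).trans ?_
  simpa using Nat.mul_le_mul_left (m i) (hG i)

theorem exists_eq_coord_mul {k : ℕ} {f : (Fin n → ℂ) → ℂ} (hf : f ∈ Pol n (k + 1)) (i : Fin n)
    (h0 : ∀ x, x i = 0 → f x = 0) : ∃ g ∈ Pol n k, ∀ x, f x = x i * g x := by
  obtain ⟨p, hp, hpf⟩ := hf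
  have hdec := divMonomial_add_modMonomial_single p i
  have hr : p.modMonomial (Finsupp.single i 1) = 0 := by
    refine MvPolynomial.funext fun x => ?_
    have h1 : ∀ x : Fin n → ℂ, eval x (p.modMonomial (Finsupp.single i 1)) =
        eval (Function.update x i 0) (p.modMonomial (Finsupp.single i 1)) := by
      intro x
      simp only [eval_eq']
      refine Finset.sum_congr rfl fun m hm => ?_
      have hmi : m i = 0 := by
        by_contra hmi
        refine (mem_support_iff.1 hm) (coeff_modMonomial_of_le _ ?_)
        rw [Finsupp.single_le_iff]
        omega
      congr 1
      refine Finset.prod_congr rfl fun j _ => ?_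
      rcases eq_or_ne j i with rfl | hj
      · simp [hmi]
      · simp [hj]
    have h2 := congrArg (eval (Function.update x i 0)) hdec
    have h3 : f (Function.update x i 0) = 0 := h0 _ (by simp)
    simp only [map_add, map_mul, eval_X, Function.update_self, zero_mul, zero_add, hpf, h3] at h2
    rw [h1, h2, map_zero]
  refine ⟨fun x => eval x (p.divMonomial (Finsupp.single i 1)), ⟨_, fun m hm => ?_, fun _ => rfl⟩,
    fun x => ?_⟩
  · rw [mem_support_iff, coeff_divMonomial, ← mem_support_iff] at hm
    have := hp _ hm
    simp only [map_add, Finsupp.degree_single] at this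
    omega
  · have h2 := congrArg (eval x) hdec
    simpa [hr, hpf] using h2.symm

theorem exists_eq_coord_sub_mul {k : ℕ} {f : (Fin n → ℂ) → ℂ} (hf : f ∈ Pol n (k + 1)) (i : Fin n)
    (c : ℂ) (h0 : ∀ x, x i = c → f x = 0) : ∃ g ∈ Pol n k, ∀ x, f x = (x i - c) * g x := by
  let s : ℂ → Fin n → (Fin n → ℂ) → ℂ := fun c j x => 1 * x j + if j = i then c else 0
  have hs : ∀ c j, s c j ∈ Pol n 2 := fun c j => affine_mem_Pol _ _ _
  obtain ⟨g, hg, hfg⟩ := exists_eq_coord_mul (comp_mem_Pol hf (hs c)) i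
    (fun x hx => h0 _ (by simp [s, hx]))
  refine ⟨_, comp_mem_Pol hg (hs (-c)), fun x => ?_⟩
  have := hfg (fun j => s (-c) j x)
  have h2 : (fun j => s c j (fun j => s (-c) j x)) = x := by
    funext j
    by_cases hj : j = i <;> simp [s, hj]
  rw [h2] at this
  rw [this]
  simp [s, sub_eq_add_neg]

theorem exists_dividedDifference {k : ℕ} {f : (Fin n → ℂ) → ℂ} (hf : f ∈ Pol n (k + 1))
    {i j : Fin n} (hij : i ≠ j) :
    ∃ g ∈ Pol n k, ∀ x, (x i - x j) * g x = f x - f (x ∘ Equiv.swap i j) := by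
  let s : ℂ → Fin n → (Fin n → ℂ) → ℂ := fun c l x => x l + (if l = i then c else 0) * x j
  have hs : ∀ c l, s c l ∈ Pol n 2 := fun c l =>
    (Pol n 2).add_mem (coord_mem_Pol 0 l) (scale_mem_Pol _ j)
  have hswap : (fun x => f (x ∘ Equiv.swap i j)) ∈ Pol n (k + 1) :=
    comp_mem_Pol hf (g := fun l x => x (Equiv.swap i j l)) (fun l => coord_mem_Pol 0 _)
  obtain ⟨g, hg, hfg⟩ := exists_eq_coord_mul
    (comp_mem_Pol ((Pol n (k + 1)).sub_mem hf hswap) (hs 1)) i (fun x hx => by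
      have : (fun l => s 1 l x) ∘ Equiv.swap i j = fun l => s 1 l x := by
        funext l
        rcases eq_or_ne l i with rfl | hli
        · simp [s, hx, hij.symm]
        rcases eq_or_ne l j with rfl | hlj
        · simp [s, hx, hij.symm]
        · simp [Equiv.swap_apply_of_ne_of_ne hli hlj]
      simp [this])
  refine ⟨_, comp_mem_Pol hg (hs (-1)), fun x => ?_⟩
  have := hfg (fun l => s (-1) l x)
  have h2 : (fun l => s 1 l (fun l => s (-1) l x)) = x := by
    funext l
    by_cases hl : l = i <;> simp [s, hl, hij.symm]
  rw [h2] at this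
  simp only [Pi.sub_apply] at this
  rw [this]
  simp [s, sub_eq_add_neg]

theorem exists_top_component {k : ℕ} {p : MvPolynomial (Fin n) ℂ} (hp : p.totalDegree ≤ k) :
    (fun x => eval x p - eval x (homogeneousComponent k p)) ∈ Pol n k := by
  refine ⟨p - homogeneousComponent k p, fun m hm => ?_, fun x => by simp⟩
  rw [mem_support_iff, coeff_sub, coeff_homogeneousComponent] at hm
  by_contra hk
  split_ifs at hm with h
  · simp at hm
  · rw [sub_zero, ← mem_support_iff] at hm
    have h3 : m.degree ≤ p.totalDegree := le_totalDegree hm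
    omega

theorem eval_mul_homogeneousComponent (k : ℕ) (p : MvPolynomial (Fin n) ℂ) (z : ℂ)
    (x : Fin n → ℂ) : eval (fun i => z * x i) (homogeneousComponent k p) =
      z ^ k * eval x (homogeneousComponent k p) := by
  simp only [eval_eq', Finset.mul_sum]
  refine Finset.sum_congr rfl fun m hm => ?_
  have : m.degree = k := by
    rw [mem_support_iff, coeff_homogeneousComponent] at hm
    by_contra h
    simp [h] at hm
  rw [← this, Finsupp.degree_eq_sum]
  simp only [mul_pow, Finset.prod_mul_distrib, Finset.prod_pow_eq_pow_sum]
  ring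

/-- `d ^ k * f (x / d)` extends to a continuous function of `d` vanishing at `0` if `f` has degree
less than `k`. -/
theorem exists_continuous_reverse {k : ℕ} {f : (Fin n → ℂ) → ℂ} (hf : f ∈ Pol n k)
    (x : Fin n → ℂ) : ∃ r : ℂ → ℂ, Continuous r ∧ r 0 = 0 ∧
      ∀ d ≠ 0, d ^ k * f (fun i => x i / d) = r d := by
  obtain ⟨p, hp, hpf⟩ := hf
  refine ⟨fun d => ∑ m ∈ p.support, coeff m p * (d ^ (k - m.degree) * ∏ i, x i ^ m i),
    by fun_prop, ?_, fun d hd => ?_⟩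
  · refine Finset.sum_eq_zero fun m hm => ?_
    have := hp m hm
    rw [zero_pow (by omega)]
    simp
  · rw [← hpf, eval_eq', Finset.mul_sum]
    refine Finset.sum_congr rfl fun m hm => ?_
    have h1 : d ^ k = d ^ (k - m.degree) * d ^ m.degree := by
      rw [← pow_add, Nat.sub_add_cancel (hp m hm).le]
    have h2 : ∏ i, (x i / d) ^ m i = (∏ i, x i ^ m i) / d ^ m.degree := by
      simp only [div_pow, Finset.prod_div_distrib, Finset.prod_pow_eq_pow_sum,
        Finsupp.degree_eq_sum]
    rw [h1, h2]
    field_simp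

end

section

/-! ### Combinatorics of compositions -/

theorem lp_eq_sum (v : Fin n → ℕ) (i : Fin n) :
    lp v i = ∑ k, if (i < k ∧ v i < v k) ∨ (k < i ∧ v i ≤ v k) then 1 else 0 := by
  rw [lp, Finset.card_filter, Finset.card_filter, ← Finset.sum_add_distrib]
  refine Finset.sum_congr rfl fun k _ => ?_
  rcases lt_trichotomy i k with h | h | h
  · simp [h, h.not_gt]
  · simp [h]
  · simp [h, h.not_gt]

theorem lp_lt (v : Fin n → ℕ) (i : Fin n) : lp v i < n := by
  rw [lp_eq_sum]
  calc _ < ∑ _k : Fin n, 1 := by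
        refine Finset.sum_lt_sum (fun k _ => by split_ifs <;> simp) ⟨i, Finset.mem_univ _, ?_⟩
        simp
    _ = n := by simp

variable {m : ℕ}

/-- The affine rotation `(v₁, …, vₙ) ↦ (v₂, …, vₙ, v₁ + 1)` of compositions. -/
def rot (v : Fin (m + 1) → ℕ) : Fin (m + 1) → ℕ :=
  Fin.snoc (α := fun _ => ℕ) (fun j => v j.succ) (v 0 + 1)

/-- The rotation `(x₁, …, xₙ) ↦ (x₂, …, xₙ, q x₁)` of points. -/
def rotPt (q : ℂ) (x : Fin (m + 1) → ℂ) : Fin (m + 1) → ℂ :=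
  Fin.snoc (α := fun _ => ℂ) (fun j => x j.succ) (q * x 0)

/-- The inverse rotation `(x₁, …, xₙ) ↦ (xₙ / q, x₁, …, xₙ₋₁)` of points. -/
def unrotPt (q : ℂ) (x : Fin (m + 1) → ℂ) : Fin (m + 1) → ℂ :=
  Fin.cons (α := fun _ => ℂ) (x (Fin.last m) / q) (fun j => x j.castSucc)

/-- The transposition of adjacent positions. -/
abbrev adj (i : Fin m) : Equiv.Perm (Fin (m + 1)) := Equiv.swap i.castSucc i.succ

@[simp] theorem rot_castSucc (v : Fin (m + 1) → ℕ) (j : Fin m) : rot v j.castSucc = v j.succ := by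
  simp [rot]

@[simp] theorem rot_last (v : Fin (m + 1) → ℕ) : rot v (Fin.last m) = v 0 + 1 := by simp [rot]

@[simp] theorem rotPt_castSucc (q : ℂ) (x : Fin (m + 1) → ℂ) (j : Fin m) :
    rotPt q x j.castSucc = x j.succ := by simp [rotPt]

@[simp] theorem rotPt_last (q : ℂ) (x : Fin (m + 1) → ℂ) :
    rotPt q x (Fin.last m) = q * x 0 := by simp [rotPt]

@[simp] theorem unrotPt_zero (q : ℂ) (x : Fin (m + 1) → ℂ) :
    unrotPt q x 0 = x (Fin.last m) / q := rfl

@[simp] theorem unrotPt_succ (q : ℂ) (x : Fin (m + 1) → ℂ) (j : Fin m) :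
    unrotPt q x j.succ = x j.castSucc := rfl

theorem unrotPt_rotPt {q : ℂ} (hq : q ≠ 0) (x : Fin (m + 1) → ℂ) :
    unrotPt q (rotPt q x) = x := by
  funext j
  refine Fin.cases ?_ (fun j => ?_) j <;> simp [hq]

theorem rotPt_unrotPt {q : ℂ} (hq : q ≠ 0) (x : Fin (m + 1) → ℂ) :
    rotPt q (unrotPt q x) = x := by
  funext j
  refine Fin.lastCases ?_ (fun j => ?_) j
  · rw [rotPt_last, unrotPt_zero, mul_div_cancel₀ _ hq]
  · simp

theorem wt_rot (v : Fin (m + 1) → ℕ) : wt (rot v) = wt v + 1 := by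
  rw [wt, wt, Fin.sum_univ_castSucc, Fin.sum_univ_succ]
  simp
  ring

theorem wt_comp (v : Fin n → ℕ) (s : Equiv.Perm (Fin n)) : wt (v ∘ s) = wt v :=
  Equiv.sum_comp s v

theorem exists_rot_eq (v : Fin (m + 1) → ℕ) (h : v (Fin.last m) ≠ 0) : ∃ v', rot v' = v := by
  refine ⟨Fin.cons (α := fun _ => ℕ) (v (Fin.last m) - 1) (fun j => v j.castSucc), ?_⟩
  funext j
  refine Fin.lastCases ?_ (fun j => ?_) j
  · rw [rot_last, Fin.cons_zero]; omega
  · simp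

theorem wt_eq_zero {v : Fin n → ℕ} (h : wt v = 0) : v = 0 := by
  funext i
  exact (Finset.sum_eq_zero_iff.1 h) i (Finset.mem_univ _)

theorem composition_induction {P : (Fin (m + 1) → ℕ) → Prop} (h0 : P 0)
    (hr : ∀ v, P v → P (rot v))
    (hs : ∀ (v : Fin (m + 1) → ℕ) (i : Fin m), v i.castSucc ≠ v i.succ → P v → P (v ∘ adj i))
    (v : Fin (m + 1) → ℕ) : P v := by
  induction hN : wt v generalizing v with
  | zero => rwa [wt_eq_zero hN]
  | succ N ih =>
    have key : ∀ (j : Fin (m + 1)) (v : Fin (m + 1) → ℕ), wt v = N + 1 → v j ≠ 0 → P v := by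
      intro j
      induction j using Fin.reverseInduction with
      | last =>
        intro v hv hl
        obtain ⟨v', rfl⟩ := exists_rot_eq v hl
        exact hr _ (ih _ (by rw [wt_rot] at hv; omega))
      | cast i hi =>
        intro v hv hvi
        by_cases hvs : v i.succ = 0
        · have h1 : P (v ∘ adj i) := hi _ (by rw [wt_comp, hv]) (by simpa using hvi)
          have h2 := hs _ i (by simpa [hvs, eq_comm] using hvi) h1
          simpa [Function.comp_assoc, ← Equiv.coe_trans] using h2
        · exact hi v hv hvs
    have : ∃ j, v j ≠ 0 := by
      by_contra! h
      simp [wt, h] at hN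
    obtain ⟨j, hj⟩ := this
    exact key j v hN hj

theorem lp_rot_last (v : Fin (m + 1) → ℕ) : lp (rot v) (Fin.last m) = lp v 0 := by
  rw [lp_eq_sum, lp_eq_sum, Fin.sum_univ_castSucc, Fin.sum_univ_succ]
  simp [(Fin.castSucc_lt_last _).not_gt]

theorem lp_rot_castSucc (v : Fin (m + 1) → ℕ) (j : Fin m) :
    lp (rot v) j.castSucc = lp v j.succ := by
  rw [lp_eq_sum, lp_eq_sum, Fin.sum_univ_castSucc, Fin.sum_univ_succ, add_comm]
  simp only [rot_castSucc, rot_last, Fin.castSucc_lt_castSucc_iff, Fin.succ_lt_succ_iff,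
    Fin.castSucc_lt_last, true_and, Fin.succ_pos, Fin.not_lt_zero, false_and, false_or,
    (Fin.castSucc_lt_last _).not_gt, or_false, Nat.lt_succ_iff]

theorem lp_snoc_zero (v : Fin m → ℕ) (i : Fin m) :
    lp (Fin.snoc (α := fun _ => ℕ) v 0) i.castSucc = lp v i := by
  rw [lp_eq_sum, lp_eq_sum, Fin.sum_univ_castSucc]
  simp [(Fin.castSucc_lt_last _).not_gt]

theorem lp_snoc_zero_last (v : Fin m → ℕ) :
    lp (Fin.snoc (α := fun _ => ℕ) v 0) (Fin.last m) = m := by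
  rw [lp_eq_sum, Fin.sum_univ_castSucc]
  simp [Fin.castSucc_lt_last]

theorem lp_comp_adj {v : Fin (m + 1) → ℕ} {i : Fin m} (h : v i.castSucc ≠ v i.succ)
    (j : Fin (m + 1)) : lp (v ∘ adj i) j = lp v (adj i j) := by
  rw [lp_eq_sum, lp_eq_sum v, ← Equiv.sum_comp (adj i) fun k => if (adj i j < k ∧
    v (adj i j) < v k) ∨ (k < adj i j ∧ v (adj i j) ≤ v k) then 1 else 0]
  refine Finset.sum_congr rfl fun k _ => ?_
  refine if_congr ?_ rfl rfl
  simp only [Function.comp]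
  have hlt : i.castSucc < i.succ := Fin.castSucc_lt_succ
  by_cases hjk : (j = i.castSucc ∧ k = i.succ) ∨ (j = i.succ ∧ k = i.castSucc)
  · rcases hjk with ⟨rfl, rfl⟩ | ⟨rfl, rfl⟩
    · simp only [Equiv.swap_apply_left, Equiv.swap_apply_right, hlt, hlt.not_gt, true_and,
        false_and, or_false, false_or]
      omega
    · simp only [Equiv.swap_apply_left, Equiv.swap_apply_right, hlt, hlt.not_gt, true_and,
        false_and, or_false, false_or]
      omega
  · have h1 : (adj i j < adj i k ↔ j < k) ∧ (adj i k < adj i j ↔ k < j) := by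
      simp only [adj, Equiv.swap_apply_def]
      simp only [Fin.ext_iff, Fin.lt_def, Fin.val_castSucc, Fin.val_succ] at hjk ⊢
      split_ifs <;> simp <;> omega
    rw [h1.1, h1.2]

theorem lp_succ_of_eq {v : Fin (m + 1) → ℕ} {i : Fin m} (h : v i.castSucc = v i.succ) :
    lp v i.succ = lp v i.castSucc + 1 := by
  have h1 : ∑ k : Fin (m + 1), (if k = i.castSucc then 1 else 0) = 1 := by simp
  refine Eq.trans ?_ (congrArg (lp v i.castSucc + ·) h1)
  rw [lp_eq_sum, lp_eq_sum, ← Finset.sum_add_distrib]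
  refine Finset.sum_congr rfl fun k _ => ?_
  have hlt : i.castSucc < i.succ := Fin.castSucc_lt_succ
  rcases eq_or_ne k i.castSucc with rfl | hk
  · simp [hlt, h]
  rcases eq_or_ne k i.succ with rfl | hk'
  · simp [h, hk, hlt.not_gt]
  · rw [if_neg hk, add_zero, h]
    refine if_congr ?_ rfl rfl
    have h2 : (i.succ < k ↔ i.castSucc < k) ∧ (k < i.succ ↔ k < i.castSucc) := by
      simp only [Fin.ext_iff, Fin.lt_def, Fin.val_castSucc, Fin.val_succ, ne_eq] at hk hk' ⊢
      omega
    rw [h2.1, h2.2]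

/-! ### Spectral vectors -/

/-- The pair `(q, t)` satisfies no monomial relation. -/
def Generic (q t : ℂ) : Prop :=
  q ≠ 0 ∧ t ≠ 0 ∧ ∀ i j : ℤ, ¬(i = 0 ∧ j = 0) → q ^ i * t ^ j ≠ 1

variable {q t : ℂ}

theorem Generic.inv (h : Generic q t) : Generic q⁻¹ t⁻¹ := by
  refine ⟨inv_ne_zero h.1, inv_ne_zero h.2.1, fun i j hij => ?_⟩
  rw [inv_zpow', inv_zpow']
  exact h.2.2 _ _ (by simpa using hij)

theorem Generic.pow_injective (h : Generic q t) {i j i' j' : ℕ}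
    (he : q ^ i * t ^ j = q ^ i' * t ^ j') : i = i' ∧ j = j' := by
  by_contra hne
  refine h.2.2 ((i : ℤ) - i') ((j : ℤ) - j') (by omega) ?_
  rw [zpow_sub₀ h.1, zpow_sub₀ h.2.1]
  simp only [zpow_natCast]
  have h1 : q ^ i' ≠ 0 := pow_ne_zero _ h.1
  have h2 : t ^ j' ≠ 0 := pow_ne_zero _ h.2.1
  field_simp
  exact he

theorem Generic.pow_ne_one (h : Generic q t) {i j : ℕ} (hij : i ≠ 0 ∨ j ≠ 0) :
    q ^ i * t ^ j ≠ 1 := by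
  intro he
  have := h.pow_injective (i' := 0) (j' := 0) (by simpa using he)
  omega

theorem Generic.ne_one (h : Generic q t) : t ≠ 1 := by
  simpa using h.pow_ne_one (i := 0) (j := 1) (by simp)

theorem spec_ne_zero (h : Generic q t) (v : Fin n → ℕ) (i : Fin n) : spec q t v i ≠ 0 :=
  mul_ne_zero (pow_ne_zero _ h.1) (pow_ne_zero _ h.2.1)

theorem spec_inv (v : Fin n → ℕ) (i : Fin n) :
    spec q⁻¹ t⁻¹ v i = (spec q t v i)⁻¹ := by
  simp [spec, mul_comm]

theorem spec_rot (v : Fin (m + 1) → ℕ) : spec q t (rot v) = rotPt q (spec q t v) := by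
  funext j
  refine Fin.lastCases ?_ (fun j => ?_) j
  · rw [rotPt_last, spec, spec, rot_last, lp_rot_last]
    ring
  · rw [rotPt_castSucc, spec, spec, rot_castSucc, lp_rot_castSucc]

theorem spec_comp_adj {v : Fin (m + 1) → ℕ} {i : Fin m} (h : v i.castSucc ≠ v i.succ) :
    spec q t (v ∘ adj i) = spec q t v ∘ adj i := by
  funext j
  simp only [spec, Function.comp, lp_comp_adj h]

theorem spec_eq_mul_of_eq {v : Fin (m + 1) → ℕ} {i : Fin m} (h : v i.castSucc = v i.succ) :
    spec q t v i.castSucc = t * spec q t v i.succ := by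
  have h1 := lp_succ_of_eq h
  have h2 := lp_lt v i.succ
  rw [spec, spec, h, show m + 1 - 1 - lp v i.castSucc = (m + 1 - 1 - lp v i.succ) + 1 by omega]
  ring

theorem spec_ne_mul_of_ne (hg : Generic q t) {v : Fin (m + 1) → ℕ} {i j : Fin (m + 1)}
    (h : v i ≠ v j) : spec q t v i ≠ t * spec q t v j := by
  intro he
  refine h (hg.pow_injective (j := m + 1 - 1 - lp v i) (j' := (m + 1 - 1 - lp v j) + 1) ?_).1
  rw [spec, spec] at he
  rw [he]
  ring

theorem spec_ne_of_ne (hg : Generic q t) {v : Fin (m + 1) → ℕ} {i j : Fin (m + 1)}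
    (h : v i ≠ v j) : spec q t v i ≠ spec q t v j :=
  fun he => h (hg.pow_injective he).1

theorem spec_adj_ne (hg : Generic q t) (v : Fin (m + 1) → ℕ) (i : Fin m) :
    spec q t v i.castSucc ≠ spec q t v i.succ := by
  by_cases h : v i.castSucc = v i.succ
  · rw [spec_eq_mul_of_eq h]
    intro he
    exact hg.ne_one (mul_right_cancel₀ (spec_ne_zero hg v i.succ) (he.trans (one_mul _).symm))
  · exact spec_ne_of_ne hg h

theorem spec_snoc_zero (v : Fin m → ℕ) : spec q t (Fin.snoc (α := fun _ => ℕ) v 0) =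
    Fin.snoc (α := fun _ => ℂ) (fun i => t * spec q t v i) 1 := by
  funext j
  refine Fin.lastCases ?_ (fun j => ?_) j
  · rw [Fin.snoc_last, spec, lp_snoc_zero_last]
    simp
  · have := lp_lt v j
    rw [Fin.snoc_castSucc, spec, spec, lp_snoc_zero, Fin.snoc_castSucc,
      show m + 1 - 1 - lp v j = (m - 1 - lp v j) + 1 by omega]
    ring

theorem spec_last_of_eq_zero {v : Fin (m + 1) → ℕ} (h : v (Fin.last m) = 0) :
    spec q t v (Fin.last m) = 1 := by
  have : v = Fin.snoc (α := fun _ => ℕ) (fun i => v i.castSucc) 0 := by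
    funext j
    refine Fin.lastCases ?_ (fun j => ?_) j <;> simp [h]
  rw [this, spec_snoc_zero, Fin.snoc_last]

theorem spec_rot_last_ne_one (hg : Generic q t) (v : Fin (m + 1) → ℕ) :
    spec q t (rot v) (Fin.last m) ≠ 1 := by
  rw [spec, rot_last]
  exact hg.pow_ne_one (Or.inl (Nat.succ_ne_zero _))

theorem spec_zero_zero : spec q t (0 : Fin (m + 1) → ℕ) 0 = t ^ m := by
  have : lp (0 : Fin (m + 1) → ℕ) 0 = 0 := by
    rw [lp_eq_sum]
    simp
  simp [spec, this]

theorem wt_snoc_zero (v : Fin m → ℕ) : wt (Fin.snoc (α := fun _ => ℕ) v 0) = wt v := by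
  rw [wt, Fin.sum_univ_castSucc]
  simp [wt]

theorem qfac_comp_adj (z : ℂ) (v : Fin (m + 1) → ℕ) (i : Fin m) :
    qfac q t z (v ∘ adj i) = qfac q t z v := by
  by_cases h : v i.castSucc = v i.succ
  · congr 1
    funext j
    simp only [Function.comp, adj, Equiv.swap_apply_def]
    split_ifs with h1 h2
    · rw [h1, h]
    · rw [h2, h]
    · rfl
  · simp only [qfac, lp_comp_adj h, Function.comp]
    exact Equiv.prod_comp (adj i)
      fun j => ∏ l ∈ Finset.range (v j), (1 - z * q ^ l / t ^ lp v j)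

theorem qfac_rot (z : ℂ) (v : Fin (m + 1) → ℕ) :
    qfac q t z (rot v) = qfac q t z v * (1 - z * q ^ v 0 / t ^ lp v 0) := by
  rw [qfac, qfac, Fin.prod_univ_castSucc, Fin.prod_univ_succ]
  simp only [rot_castSucc, lp_rot_castSucc, rot_last, lp_rot_last, Finset.prod_range_succ]
  ring

theorem qfac_zero (z : ℂ) : qfac q t z (0 : Fin n → ℕ) = 1 := by simp [qfac]

theorem pow_mul_div_eq (ht : t ≠ 0) (v : Fin (m + 1) → ℕ) (i : Fin (m + 1)) :
    q ^ v i / t ^ lp v i = spec q t v i / t ^ m := by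
  have := lp_lt v i
  rw [spec, div_eq_div_iff (pow_ne_zero _ ht) (pow_ne_zero _ ht), mul_assoc, ← pow_add]
  congr 2
  omega

theorem continuous_qfac (v : Fin n → ℕ) : Continuous fun z => qfac q t z v := by
  unfold qfac
  fun_prop

end

section

/-! ### Interpolation at spectral vectors -/

variable {m : ℕ} {q t : ℂ}

theorem eq_zero_of_vanishes_spec (hg : Generic q t) {k : ℕ} {f : (Fin n → ℂ) → ℂ}
    (hf : f ∈ Pol n k) (h0 : ∀ v, wt v < k → f (spec q t v) = 0) : f = 0 := by
  induction n generalizing k with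
  | zero =>
    rcases k with _ | k
    · exact eq_zero_of_mem_Pol_zero hf
    · funext x
      rw [Subsingleton.elim x (spec q t (fun _ => 0))]
      exact h0 _ (by simp [wt])
  | succ m ih =>
    induction k generalizing f with
    | zero => exact eq_zero_of_mem_Pol_zero hf
    | succ k ihk =>
      have hr : (fun y : Fin m → ℂ => f (fun j =>
          Fin.snoc (α := fun _ => ℂ) (fun i => t * y i) 1 j)) = 0 := by
        refine ih (comp_mem_Pol hf fun j => ?_) fun v hv => ?_
        · refine Fin.lastCases ?_ (fun j => ?_) j
          · simpa using const_mem_Pol 1 (1 : ℂ)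
          · simpa using scale_mem_Pol t j
        · rw [← h0 _ ((wt_snoc_zero v).trans_lt hv), spec_snoc_zero]
      obtain ⟨g, hgm, hfg⟩ := exists_eq_coord_sub_mul hf (Fin.last m) 1 fun x hx => by
        refine Eq.trans (congrArg f ?_) (congrFun hr fun i => x i.castSucc / t)
        funext j
        refine Fin.lastCases ?_ (fun j => ?_) j
        · simp [hx]
        · simp [mul_div_cancel₀ _ hg.2.1]
      have hgr : (fun x => g (fun j => rotPt q x j)) = 0 := by
        refine ihk (comp_mem_Pol hgm fun j => ?_) fun v hv => ?_
        · refine Fin.lastCases ?_ (fun j => ?_) j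
          · simpa using scale_mem_Pol q (0 : Fin (m + 1))
          · simpa using coord_mem_Pol 0 j.succ
        · have h1 := h0 (rot v) (by rw [wt_rot]; omega)
          rw [hfg, mul_eq_zero, sub_eq_zero] at h1
          exact spec_rot v ▸ h1.resolve_left (spec_rot_last_ne_one hg v)
      funext x
      have := congrFun hgr (unrotPt q x)
      simp only [rotPt_unrotPt hg.1, Pi.zero_apply] at this
      rw [hfg, this, mul_zero, Pi.zero_apply]

/-- The point `(t^{n-1}/⟨w⟩ₙ, …, t^{n-1}/⟨w⟩₁)`. -/
def dualPt (q t : ℂ) (w : Fin (m + 1) → ℕ) : Fin (m + 1) → ℂ :=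
  fun i => t ^ m / spec q t w i.rev

theorem eq_zero_of_vanishes_dualPt (hg : Generic q t) {k : ℕ} {f : (Fin (m + 1) → ℂ) → ℂ}
    (hf : f ∈ Pol (m + 1) k) {d : ℂ} (hd : d ≠ 0)
    (h0 : ∀ w, wt w < k → f (fun i => dualPt q t w i / d) = 0) : f = 0 := by
  have h1 : (fun x : Fin (m + 1) → ℂ => f (fun i => t ^ m / d * x i.rev)) = 0 := by
    refine eq_zero_of_vanishes_spec hg.inv (comp_mem_Pol hf fun i => scale_mem_Pol _ _)
      fun v hv => ?_
    rw [← h0 v hv]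
    congr 1
    funext i
    rw [spec_inv, dualPt]
    ring
  funext x
  have h2 := congrFun h1 (fun i => x i.rev / (t ^ m / d))
  have h3 : t ^ m / d ≠ 0 := div_ne_zero (pow_ne_zero _ hg.2.1) hd
  simp only [Fin.rev_rev, mul_div_cancel₀ _ h3] at h2
  exact h2

theorem eq_zero_of_vanishes_spec_inv (hg : Generic q t) {k : ℕ} {f : (Fin n → ℂ) → ℂ}
    (hf : f ∈ Pol n k) (h0 : ∀ v, wt v < k → f (fun i => (spec q t v i)⁻¹) = 0) : f = 0 := by
  refine eq_zero_of_vanishes_spec hg.inv hf fun v hv => ?_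
  rw [← h0 v hv]
  congr 1
  funext i
  exact spec_inv v i

theorem spec_zero (i : Fin (m + 1)) : spec q t (0 : Fin (m + 1) → ℕ) i = t ^ (m - i) := by
  have : lp (0 : Fin (m + 1) → ℕ) i = i := by
    have h : (Finset.univ.filter fun k => k < i) = Finset.Iio i := by
      ext
      simp
    simp [lp, h]
  simp [spec, this]

theorem dualPt_zero (ht : t ≠ 0) : dualPt q t (0 : Fin (m + 1) → ℕ) = spec q t 0 := by
  funext i
  rw [dualPt, spec_zero, spec_zero, div_eq_iff (pow_ne_zero _ ht), ← pow_add]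
  congr 1
  have := i.2
  rw [Fin.val_rev]
  omega

/-- Families of functions with the degree and vanishing properties of the interpolation
Macdonald polynomials. -/
def IsInterp (q t : ℂ) (f : (Fin n → ℕ) → (Fin n → ℂ) → ℂ) : Prop :=
  ∀ u, f u ∈ Pol n (wt u + 1) ∧ f u (spec q t u) ≠ 0 ∧
    ∀ v, wt v ≤ wt u → v ≠ u → f u (spec q t v) = 0

theorem IsInterpFamily.isInterp {M : (Fin n → ℕ) → MvPolynomial (Fin n) ℂ} (hg : Generic q t)
    (hM : IsInterpFamily q t M) : IsInterp q t fun u x => eval x (M u) := by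
  intro u
  have hmem := eval_mem_Pol (hM u).1
  refine ⟨hmem, fun h0 => ?_, (hM u).2.2⟩
  have h1 := eq_zero_of_vanishes_spec hg hmem fun v hv => by
    rcases eq_or_ne v u with rfl | hvu
    · exact h0
    · exact (hM u).2.2 v (by omega) hvu
  have h2 : M u = 0 := MvPolynomial.funext fun x => by simpa using congrFun h1 x
  have h3 := (hM u).2.1
  rw [h2, coeff_zero, eq_comm, inv_eq_zero] at h3
  exact pow_ne_zero _ hg.1 h3

variable {f : (Fin (m + 1) → ℕ) → (Fin (m + 1) → ℂ) → ℂ}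

theorem IsInterp.eq_mul {f : (Fin n → ℕ) → (Fin n → ℂ) → ℂ} (hg : Generic q t)
    (hf : IsInterp q t f) {u : Fin n → ℕ}
    {g : (Fin n → ℂ) → ℂ} (hgm : g ∈ Pol n (wt u + 1))
    (h0 : ∀ v, wt v ≤ wt u → v ≠ u → g (spec q t v) = 0) (x : Fin n → ℂ) :
    g x = g (spec q t u) / f u (spec q t u) * f u x := by
  have h1 := eq_zero_of_vanishes_spec hg
    ((Pol n _).sub_mem hgm ((Pol n _).smul_mem (g (spec q t u) / f u (spec q t u)) (hf u).1))
    fun v hv => by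
      rcases eq_or_ne v u with rfl | hvu
      · simp [div_mul_cancel₀ _ (hf v).2.1]
      · simp [h0 v (by omega) hvu, (hf u).2.2 v (by omega) hvu]
  simpa [sub_eq_zero] using congrFun h1 x

/-! ### Demazure–Lusztig operators -/

theorem exists_hecke {k : ℕ} {g : (Fin (m + 1) → ℂ) → ℂ} (hg : g ∈ Pol (m + 1) (k + 1))
    (t : ℂ) (i : Fin m) : ∃ T ∈ Pol (m + 1) (k + 1),
      (∀ x, (x i.castSucc - x i.succ) * T x =
        (t - 1) * x i.castSucc * g x + (x i.castSucc - t * x i.succ) * g (x ∘ adj i)) ∧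
      ∀ x, x i.castSucc = 0 → T x = t * g (x ∘ adj i) := by
  obtain ⟨h, hh, hdd⟩ := exists_dividedDifference hg (i := i.castSucc) (j := i.succ)
    Fin.castSucc_lt_succ.ne
  have hs : (fun x => g (fun j => x (adj i j))) ∈ Pol (m + 1) (k + 1) :=
    comp_mem_Pol hg fun j => coord_mem_Pol 0 _
  have hxh : (fun x => x i.castSucc * h x) ∈ Pol (m + 1) (k + 1) := by
    rcases k with _ | k
    · rw [eq_zero_of_mem_Pol_zero hh]
      simp only [Pi.zero_apply, mul_zero]
      exact const_mem_Pol 0 0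
    · exact Pol_mono (by omega) (mul_mem_Pol (coord_mem_Pol 0 i.castSucc) hh)
  refine ⟨_, (Pol _ _).add_mem ((Pol _ _).smul_mem t hs) ((Pol _ _).smul_mem (t - 1) hxh),
    fun x => ?_, fun x hx => ?_⟩
  · have := hdd x
    simp only [Pi.add_apply, Pi.smul_apply, smul_eq_mul]
    change _ = _ + _ * g (fun j => x (adj i j))
    change _ = _ - g (fun j => x (adj i j)) at this
    linear_combination (t - 1) * x i.castSucc * this
  · simp [hx, Function.comp_def]

theorem hecke_vanishes (hg : Generic q t) {g T : (Fin (m + 1) → ℂ) → ℂ} {i : Fin m}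
    (hT : ∀ x, (x i.castSucc - x i.succ) * T x =
        (t - 1) * x i.castSucc * g x + (x i.castSucc - t * x i.succ) * g (x ∘ adj i))
    {v : Fin (m + 1) → ℕ} (h0 : g (spec q t v) = 0)
    (h1 : v i.castSucc ≠ v i.succ → g (spec q t (v ∘ adj i)) = 0) : T (spec q t v) = 0 := by
  have h2 := hT (spec q t v)
  refine (mul_eq_zero.1 (h2.trans ?_)).resolve_left (sub_ne_zero.2 (spec_adj_ne hg v i))
  rw [h0, mul_zero, zero_add]
  by_cases hv : v i.castSucc = v i.succ
  · rw [spec_eq_mul_of_eq hv, sub_self, zero_mul]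
  · rw [← spec_comp_adj hv, h1 hv, mul_zero]

/-- The scalar by which the Demazure–Lusztig operator acts, up to a triangular term. -/
def heckeCoeff (q t : ℂ) (u : Fin (m + 1) → ℕ) (i : Fin m) : ℂ :=
  (t - 1) * spec q t u i.castSucc / (spec q t u i.castSucc - spec q t u i.succ)

theorem comp_adj_comp_adj {α : Type*} (x : Fin (m + 1) → α) (i : Fin m) :
    (x ∘ adj i) ∘ adj i = x := by
  funext j
  simp

theorem comp_adj_of_eq {u : Fin (m + 1) → ℕ} {i : Fin m} (h : u i.castSucc = u i.succ) :
    u ∘ adj i = u := by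
  funext j
  simp only [Function.comp, Equiv.swap_apply_def]
  split_ifs with h1 h2
  · rw [h1, h]
  · rw [h2, h]
  · rfl

theorem IsInterp.hecke (hg : Generic q t) (hf : IsInterp q t f) (u : Fin (m + 1) → ℕ)
    (i : Fin m) : ∃ β : ℂ, (u i.castSucc = u i.succ ↔ β = 0) ∧ ∀ x,
      (t - 1) * x i.castSucc * f u x + (x i.castSucc - t * x i.succ) * f u (x ∘ adj i) =
        (x i.castSucc - x i.succ) * (heckeCoeff q t u i * f u x + β * f (u ∘ adj i) x) := by
  obtain ⟨T, hTm, hT, -⟩ := exists_hecke (hf u).1 t i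
  set α := heckeCoeff q t u i with hα
  have hne := sub_ne_zero.2 (spec_adj_ne hg u i)
  set G : (Fin (m + 1) → ℂ) → ℂ := fun x => T x - α * f u x with hG
  have hGm : G ∈ Pol (m + 1) (wt (u ∘ adj i) + 1) := by
    rw [wt_comp]
    exact (Pol _ _).sub_mem hTm ((Pol _ _).smul_mem α (hf u).1)
  have hGu : G (spec q t u) = 0 := by
    have h1 := hT (spec q t u)
    have h2 : (spec q t u i.castSucc - t * spec q t u i.succ) * f u (spec q t u ∘ adj i) = 0 := by
      by_cases hv : u i.castSucc = u i.succ
      · rw [spec_eq_mul_of_eq hv, sub_self, zero_mul]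
      · rw [← spec_comp_adj hv, (hf u).2.2 _ (wt_comp u _).le, mul_zero]
        intro he
        have := congrFun he i.castSucc
        simp at this
        exact hv this.symm
    rw [h2, add_zero] at h1
    rw [hG, hα, heckeCoeff]
    field_simp
    linear_combination h1
  have hGv : ∀ v, wt v ≤ wt (u ∘ adj i) → v ≠ u ∘ adj i → G (spec q t v) = 0 := by
    intro v hv hvu
    rw [wt_comp] at hv
    rcases eq_or_ne v u with rfl | hvu'
    · exact hGu
    · rw [hG]
      dsimp only
      rw [(hf u).2.2 v hv hvu', hecke_vanishes hg hT ((hf u).2.2 v hv hvu') fun _ =>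
        (hf u).2.2 _ ((wt_comp v _).trans_le hv) fun he => hvu (by rw [← he, comp_adj_comp_adj])]
      ring
  refine ⟨G (spec q t (u ∘ adj i)) / f (u ∘ adj i) (spec q t (u ∘ adj i)),
    ⟨fun hu => ?_, fun h0 => ?_⟩, fun x => ?_⟩
  rotate_left 2
  · rw [← hT x, ← hf.eq_mul hg hGm hGv x, hG]
    ring
  · rw [comp_adj_of_eq hu, hGu, zero_div]
  · by_contra hu
    have h1 := hT (spec q t (u ∘ adj i))
    have hus : u ∘ adj i ≠ u := by
      intro he
      have := congrFun he i.castSucc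
      simp at this
      exact hu this.symm
    have h2 : G (spec q t (u ∘ adj i)) = 0 := by
      simpa [(hf (u ∘ adj i)).2.1] using h0
    rw [hG] at h2
    dsimp only at h2
    have h3 := (hf u).2.2 _ (wt_comp u (adj i)).le hus
    rw [h3, mul_zero, sub_zero] at h2
    rw [h2, h3, spec_comp_adj hu, comp_adj_comp_adj, mul_zero, mul_zero, zero_add, eq_comm,
      mul_eq_zero] at h1
    refine h1.elim (fun h => ?_) (hf u).2.1
    simp only [Function.comp, Equiv.swap_apply_left, Equiv.swap_apply_right] at h
    exact spec_ne_mul_of_ne hg (Ne.symm hu) (sub_eq_zero.1 h)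

/-! ### The affine operator -/

theorem affine_mem {k : ℕ} {g : (Fin (m + 1) → ℂ) → ℂ} (hgm : g ∈ Pol (m + 1) (k + 1)) (q : ℂ) :
    (fun x => (x (Fin.last m) - 1) * g (unrotPt q x)) ∈ Pol (m + 1) (k + 2) := by
  have h1 : (fun x => g (fun j => unrotPt q x j)) ∈ Pol (m + 1) (k + 1) := by
    refine comp_mem_Pol hgm fun j => ?_
    refine Fin.cases ?_ (fun j => ?_) j
    · simpa [div_eq_inv_mul] using scale_mem_Pol q⁻¹ (Fin.last m)
    · simpa using coord_mem_Pol 0 j.castSucc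
  have h2 := mul_mem_Pol (affine_mem_Pol 1 (-1) (Fin.last m)) h1
  refine Pol_mono (k := 1 + k + 1) (by omega) ?_
  simpa [sub_eq_add_neg] using h2

theorem affine_vanishes (hg : Generic q t) {u : Fin (m + 1) → ℕ}
    {g : (Fin (m + 1) → ℂ) → ℂ} (h0 : ∀ v, wt v ≤ wt u → v ≠ u → g (spec q t v) = 0)
    {v : Fin (m + 1) → ℕ} (hv : wt v ≤ wt u + 1) (hvu : v ≠ rot u) :
    (spec q t v (Fin.last m) - 1) * g (unrotPt q (spec q t v)) = 0 := by
  by_cases h : v (Fin.last m) = 0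
  · rw [spec_last_of_eq_zero h, sub_self, zero_mul]
  · obtain ⟨v, rfl⟩ := exists_rot_eq v h
    rw [wt_rot] at hv
    rw [spec_rot v, unrotPt_rotPt hg.1, h0 v (by omega) fun he => hvu (by rw [he]), mul_zero]

theorem IsInterp.affine (hg : Generic q t) (hf : IsInterp q t f) (u : Fin (m + 1) → ℕ) :
    ∃ γ : ℂ, γ ≠ 0 ∧ ∀ x, (x (Fin.last m) - 1) * f u (unrotPt q x) = γ * f (rot u) x := by
  have hm := affine_mem (hf u).1 q
  rw [show wt u + 2 = wt (rot u) + 1 by rw [wt_rot]] at hm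
  refine ⟨_, ?_, hf.eq_mul hg hm fun v hv hvu =>
    affine_vanishes hg (hf u).2.2 (hv.trans (wt_rot u).le) hvu⟩
  refine div_ne_zero (mul_ne_zero (sub_ne_zero.2 (spec_rot_last_ne_one hg u)) ?_) (hf _).2.1
  rw [spec_rot, unrotPt_rotPt hg.1]
  exact (hf u).2.1

theorem spec0div_adj (d : ℂ) (i : Fin m) :
    spec0div q t d i.castSucc = t * spec0div q t d i.succ := by
  rw [spec0div, spec0div]
  have : spec q t (fun _ => 0) i.castSucc = t * spec q t (fun _ => 0) i.succ :=
    spec_eq_mul_of_eq rfl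
  rw [this]
  ring

theorem spec0div_ne_zero (hg : Generic q t) {d : ℂ} (hd : d ≠ 0) (i : Fin n) :
    spec0div q t d i ≠ 0 := div_ne_zero (spec_ne_zero hg _ _) hd

theorem hecke_spec0div (hg : Generic q t) {g T : (Fin (m + 1) → ℂ) → ℂ} {i : Fin m}
    (hT : ∀ x, (x i.castSucc - x i.succ) * T x =
        (t - 1) * x i.castSucc * g x + (x i.castSucc - t * x i.succ) * g (x ∘ adj i))
    {d : ℂ} (hd : d ≠ 0) : T (spec0div q t d) = t * g (spec0div q t d) := by
  have h1 := hT (spec0div q t d)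
  rw [spec0div_adj] at h1
  refine mul_left_cancel₀ (mul_ne_zero (sub_ne_zero.2 hg.ne_one)
    (spec0div_ne_zero hg hd i.succ)) ?_
  linear_combination h1

theorem adj_succAbove (i : Fin m) (k : Fin m) :
    adj i (i.succ.succAbove k) = i.castSucc.succAbove k := by
  simp only [Equiv.swap_apply_def, Fin.succAbove, Fin.ext_iff, Fin.lt_def, Fin.val_castSucc,
    Fin.val_succ]
  split_ifs <;> simp at * <;> omega

theorem IsInterp.affine_spec0div (hg : Generic q t) (hf : IsInterp q t f)
    (u : Fin (m + 1) → ℕ) {d : ℂ} (hd : d ≠ 0) :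
    (spec0div q t d (Fin.last m) - 1) * f u (unrotPt q (spec0div q t d)) =
      (t ^ m / (spec q t u 0 * d) - 1) * f u (spec0div q t d) := by
  have key : ∀ j : Fin (m + 1), ∃ P ∈ Pol (m + 1) (wt u + 2),
      (∀ v, wt v ≤ wt u → P (spec q t v) = 0) ∧
      (∀ x, x j = 0 → P x = -t ^ (m - j) *
        f u (Fin.cons (α := fun _ => ℂ) 0 fun k => x (j.succAbove k))) ∧
      P (spec0div q t d) = t ^ (m - j) *
        ((spec0div q t d (Fin.last m) - 1) * f u (unrotPt q (spec0div q t d))) := by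
    intro j
    induction j using Fin.reverseInduction with
    | last =>
      refine ⟨_, affine_mem (hf u).1 q, fun v hv => ?_, fun x hx => ?_, by simp⟩
      · refine affine_vanishes hg (hf u).2.2 (by omega) fun he => ?_
        rw [he, wt_rot] at hv
        omega
      · simp [hx, unrotPt]
    | cast i ih =>
      obtain ⟨P, hPm, hP0, hPx, hPd⟩ := ih
      obtain ⟨T, hTm, hT, hT0⟩ := exists_hecke hPm t i
      have hp : t ^ (m - i.castSucc.val) = t * t ^ (m - i.succ.val) := by
        rw [← pow_succ']
        congr 1
        have := i.2
        simp
        omega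
      refine ⟨T, hTm, fun v hv => hecke_vanishes hg hT (hP0 v hv) fun _ =>
        hP0 _ ((wt_comp v _).trans_le hv), fun x hx => ?_, ?_⟩
      · rw [hT0 x hx, hPx _ (by simpa using hx), hp]
        simp only [Function.comp, adj_succAbove]
        ring
      · rw [hecke_spec0div hg hT hd, hPd, hp]
        ring
  obtain ⟨P, hPm, hP0, hPx, hPd⟩ := key 0
  have ht : t ^ m ≠ 0 := pow_ne_zero _ hg.2.1
  simp only [Fin.val_zero, tsub_zero] at hPx hPd
  obtain ⟨R, hRm, hR⟩ := exists_eq_coord_mul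
    ((Pol _ _).add_mem ((Pol _ _).smul_mem (t ^ m) (Pol_mono (Nat.le_succ _) (hf u).1)) hPm) 0
    fun x hx => by
      have : (Fin.cons (α := fun _ => ℂ) 0 fun k => x ((0 : Fin (m + 1)).succAbove k)) = x := by
        funext j
        refine Fin.cases ?_ (fun j => ?_) j <;> simp [hx]
      rw [Pi.add_apply, hPx x hx, this]
      simp
  have hs := spec_ne_zero hg u 0
  have h1 := eq_zero_of_vanishes_spec hg
    ((Pol _ _).sub_mem hRm ((Pol _ _).smul_mem (t ^ m / spec q t u 0) (hf u).1)) fun v hv => by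
      have h2 := hR (spec q t v)
      simp only [Pi.add_apply, Pi.smul_apply, smul_eq_mul, hP0 v (by omega), add_zero] at h2
      refine mul_left_cancel₀ (spec_ne_zero hg v 0) ?_
      simp only [Pi.sub_apply, Pi.smul_apply, smul_eq_mul]
      rw [mul_sub, ← h2]
      rcases eq_or_ne v u with rfl | hvu
      · field_simp
        ring
      · simp [(hf u).2.2 v (by omega) hvu]
  have h2 := hR (spec0div q t d)
  have h3 := congrFun h1 (spec0div q t d)
  simp only [Pi.sub_apply, Pi.add_apply, Pi.smul_apply, smul_eq_mul, hPd, Pi.zero_apply] at h2 h3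
  have h4 : spec0div q t d (0 : Fin (m + 1)) = t ^ m / d := congrArg (· / d) spec_zero_zero
  rw [sub_eq_zero.1 h3, h4] at h2
  refine mul_left_cancel₀ ht ?_
  linear_combination h2

/-! ### Evaluation at the zero spectral vector -/

theorem IsInterp.eval_spec0div (hg : Generic q t) (hf : IsInterp q t f) (u : Fin (m + 1) → ℕ) :
    ∃ c : ℂ, c ≠ 0 ∧ ∀ d, d ≠ 0 → f u (spec0div q t d) = c * (d ^ wt u)⁻¹ * qfac q t d u := by
  induction u using composition_induction with
  | h0 =>
    refine ⟨_, (hf 0).2.1, fun d _ => ?_⟩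
    have h1 := (hf 0).1
    rw [show wt (0 : Fin (m + 1) → ℕ) = 0 by simp [wt]] at h1 ⊢
    have h2 := eq_zero_of_vanishes_spec hg
      ((Pol _ _).sub_mem h1 (const_mem_Pol 0 (f 0 (spec q t 0)))) fun v hv => by
        rw [wt_eq_zero (Nat.lt_one_iff.1 hv)]
        simp
    have h3 := congrFun h2 (spec0div q t d)
    simpa [qfac_zero, sub_eq_zero] using h3
  | hr u ih =>
    obtain ⟨c, hc, hcd⟩ := ih
    obtain ⟨γ, hγ, hγx⟩ := hf.affine hg u
    have hs := spec_ne_zero hg u 0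
    have ht : t ^ m ≠ 0 := pow_ne_zero _ hg.2.1
    refine ⟨t ^ m * c / (spec q t u 0 * γ), by positivity, fun d hd => ?_⟩
    have h1 := hf.affine_spec0div hg u hd
    rw [hγx, hcd d hd] at h1
    rw [qfac_rot, wt_rot, mul_div_assoc d, pow_mul_div_eq hg.2.1]
    refine mul_left_cancel₀ hγ (h1.trans ?_)
    field_simp
    ring
  | hs u i hu ih =>
    obtain ⟨c, hc, hcd⟩ := ih
    obtain ⟨β, hβ, hβx⟩ := hf.hecke hg u i
    have hβ0 : β ≠ 0 := fun h => hu (hβ.2 h)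
    have hne := sub_ne_zero.2 (spec_adj_ne hg u i)
    have hα : t - heckeCoeff q t u i ≠ 0 := by
      rw [heckeCoeff, sub_ne_zero, Ne, eq_div_iff hne]
      intro h
      refine spec_ne_mul_of_ne hg hu ?_
      linear_combination h
    refine ⟨(t - heckeCoeff q t u i) * c / β, div_ne_zero (mul_ne_zero hα hc) hβ0, fun d hd => ?_⟩
    have h1 := hβx (spec0div q t d)
    rw [spec0div_adj] at h1
    rw [qfac_comp_adj, wt_comp]
    have h2 : t * f u (spec0div q t d) =
        heckeCoeff q t u i * f u (spec0div q t d) + β * f (u ∘ adj i) (spec0div q t d) := by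
      refine mul_left_cancel₀ (mul_ne_zero (sub_ne_zero.2 hg.ne_one)
        (spec0div_ne_zero hg hd i.succ)) ?_
      linear_combination h1
    rw [hcd d hd] at h2
    field_simp at h2 ⊢
    linear_combination -h2

end

section

/-! ### Duality -/

variable {m : ℕ} {q t : ℂ} {f : (Fin (m + 1) → ℕ) → (Fin (m + 1) → ℂ) → ℂ}

theorem dualPt_rot (w : Fin (m + 1) → ℕ) :
    dualPt q t (rot w) = unrotPt q (dualPt q t w) := by
  funext j
  refine Fin.cases ?_ (fun j => ?_) j
  · rw [unrotPt_zero, dualPt, dualPt, Fin.rev_zero, Fin.rev_last, spec_rot, rotPt_last,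
      mul_comm, div_div]
  · rw [unrotPt_succ, dualPt, dualPt, Fin.rev_succ, Fin.rev_castSucc, spec_rot, rotPt_castSucc]

theorem adj_rev (i : Fin m) (j : Fin (m + 1)) : adj i j.rev = (adj i.rev j).rev := by
  simp only [adj, Equiv.swap_apply_def, ← Fin.rev_succ, ← Fin.rev_castSucc]
  simp only [Fin.rev_eq_iff (j := i.castSucc), Fin.rev_eq_iff (j := i.succ)]
  by_cases h1 : j = i.castSucc.rev
  · simp [h1, (Fin.castSucc_lt_succ (i := i)).ne]
  · by_cases h2 : j = i.succ.rev <;> simp [h1, h2]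

theorem dualPt_comp_adj {w : Fin (m + 1) → ℕ} {i : Fin m} (h : w i.castSucc ≠ w i.succ) :
    dualPt q t (w ∘ adj i) = dualPt q t w ∘ adj i.rev := by
  funext j
  simp only [dualPt, spec_comp_adj h, Function.comp, adj_rev]

theorem eval_spec0div_comp_adj (hg : Generic q t) {u : Fin (m + 1) → ℕ} {i : Fin m} {β : ℂ}
    (hβ : ∀ x, (t - 1) * x i.castSucc * f u x + (x i.castSucc - t * x i.succ) * f u (x ∘ adj i) =
        (x i.castSucc - x i.succ) * (heckeCoeff q t u i * f u x + β * f (u ∘ adj i) x))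
    {d : ℂ} (hd : d ≠ 0) :
    β * f (u ∘ adj i) (spec0div q t d) = (t - heckeCoeff q t u i) * f u (spec0div q t d) := by
  have h1 := hβ (spec0div q t d)
  rw [spec0div_adj] at h1
  refine mul_left_cancel₀ (mul_ne_zero (sub_ne_zero.2 hg.ne_one)
    (spec0div_ne_zero hg hd i.succ)) ?_
  linear_combination -h1

theorem heckeCoeff_of_eq (hg : Generic q t) {u : Fin (m + 1) → ℕ} {i : Fin m}
    (h : u i.castSucc = u i.succ) : heckeCoeff q t u i = t := by
  have hne := sub_ne_zero.2 (spec_adj_ne hg u i)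
  rw [heckeCoeff, div_eq_iff hne, spec_eq_mul_of_eq h]
  ring

theorem IsInterp.exists_dual (hg : Generic q t) (hf : IsInterp q t f) {d : ℂ} (hd : d ≠ 0)
    (hdv : ∀ v : Fin (m + 1) → ℕ, qfac q t d v ≠ 0) (w : Fin (m + 1) → ℕ) :
    ∃ O ∈ Pol (m + 1) (wt w + 1), ∀ u, f u (fun i => dualPt q t w i / d) =
      O (fun i => (spec q t u i)⁻¹) * f u (spec0div q t d) := by
  induction w using composition_induction with
  | h0 =>
    refine ⟨_, const_mem_Pol _ 1, fun u => ?_⟩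
    rw [one_mul, dualPt_zero hg.2.1]
    rfl
  | hr w ih =>
    obtain ⟨O, hOm, hO⟩ := ih
    have hs := spec_ne_zero hg w 0
    have ht : t ^ m ≠ 0 := pow_ne_zero _ hg.2.1
    have hne : dualPt q t w (Fin.last m) / d - 1 ≠ 0 := by
      have h1 := hdv (rot w)
      rw [qfac_rot, mul_div_assoc, pow_mul_div_eq hg.2.1] at h1
      have h2 := right_ne_zero_of_mul h1
      rw [dualPt, Fin.rev_last]
      contrapose! h2
      field_simp at h2 ⊢
      linear_combination h2
    have hOr : (fun z => O (fun j => rotPt q⁻¹ z j)) ∈ Pol (m + 1) (wt w + 1) := by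
      refine comp_mem_Pol hOm fun j => ?_
      refine Fin.lastCases ?_ (fun j => ?_) j
      · simpa using scale_mem_Pol q⁻¹ (0 : Fin (m + 1))
      · simpa using coord_mem_Pol 0 j.succ
    have hm := (Pol _ _).smul_mem (dualPt q t w (Fin.last m) / d - 1)⁻¹
      (mul_mem_Pol (affine_mem_Pol (t ^ m / d) (-1) 0) hOr)
    refine ⟨_, Pol_mono (by rw [wt_rot]; omega) hm, fun u => ?_⟩
    obtain ⟨γ, hγ, hγx⟩ := hf.affine hg u
    have h1 := hγx (fun i => dualPt q t w i / d)
    have h2 : unrotPt q (fun i => dualPt q t w i / d) = fun i => dualPt q t (rot w) i / d := by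
      rw [dualPt_rot]
      funext j
      refine Fin.cases ?_ (fun j => ?_) j
      · simp only [unrotPt_zero]
        ring
      · simp
    have h3 : (fun j => (spec q t (rot u) j)⁻¹) = rotPt q⁻¹ fun i => (spec q t u i)⁻¹ := by
      rw [spec_rot]
      funext j
      refine Fin.lastCases ?_ (fun j => ?_) j
      · simp only [rotPt_last, mul_inv]
      · simp
    have h4 := hf.affine_spec0div hg u hd
    rw [hγx] at h4
    rw [h2, hO, h3] at h1
    refine mul_left_cancel₀ hne (h1.trans ?_)
    simp only [Pi.smul_apply, smul_eq_mul]
    rw [mul_assoc _ _ (f u _), mul_inv_cancel_left₀ hne, ← mul_assoc, mul_right_comm, h4,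
      mul_comm (spec q t u 0), ← div_div, div_eq_mul_inv _ (spec q t u 0)]
    ring_nf
  | hs w i hw ih =>
    obtain ⟨O, hOm, hO⟩ := ih
    have ht : t ^ m ≠ 0 := pow_ne_zero _ hg.2.1
    set x : Fin (m + 1) → ℂ := fun i => dualPt q t w i / d with hx
    have hxs : (fun j => dualPt q t (w ∘ adj i) j / d) = x ∘ adj i.rev := by
      rw [dualPt_comp_adj hw]
      rfl
    have hne : x i.rev.castSucc - t * x i.rev.succ ≠ 0 := by
      simp only [hx, dualPt, Fin.rev_castSucc, Fin.rev_succ, Fin.rev_rev]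
      have h1 := spec_ne_zero hg w i.castSucc
      have h2 := spec_ne_zero hg w i.succ
      have h3 := spec_ne_mul_of_ne hg hw
      contrapose! h3
      field_simp at h3
      refine mul_left_cancel₀ ht ?_
      linear_combination h3
    obtain ⟨h, hh, hdd⟩ := exists_dividedDifference hOm (i := i.rev.castSucc) (j := i.rev.succ)
      Fin.castSucc_lt_succ.ne
    have hOs : (fun z => O (fun j => z (adj i.rev j))) ∈ Pol (m + 1) (wt w + 1) :=
      comp_mem_Pol hOm fun j => coord_mem_Pol 0 _
    have hzh : (fun z => z i.rev.succ * h z) ∈ Pol (m + 1) (wt w + 1) := by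
      rcases hk : wt w with _ | k
      · rw [hk] at hh
        rw [eq_zero_of_mem_Pol_zero hh]
        simp only [Pi.zero_apply, mul_zero]
        exact const_mem_Pol 0 0
      · rw [hk] at hh
        exact Pol_mono (by omega) (mul_mem_Pol (coord_mem_Pol 0 i.rev.succ) hh)
    have hKm := (Pol _ _).sub_mem ((Pol _ _).smul_mem t hOs) ((Pol _ _).smul_mem (t - 1) hzh)
    have hRm := (Pol _ _).smul_mem (x i.rev.castSucc - t * x i.rev.succ)⁻¹
      ((Pol _ _).sub_mem ((Pol _ _).smul_mem (x i.rev.castSucc - x i.rev.succ) hKm)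
        ((Pol _ _).smul_mem ((t - 1) * x i.rev.castSucc) hOm))
    refine ⟨_, by rw [wt_comp]; exact hRm, fun u => ?_⟩
    obtain ⟨β, hβ, hβx⟩ := hf.hecke hg u i.rev
    have h1 := eval_spec0div_comp_adj hg hβx hd
    have h2 := hβx x
    set z : Fin (m + 1) → ℂ := fun i => (spec q t u i)⁻¹ with hz
    have h3 : β * f (u ∘ adj i.rev) x =
        (t - heckeCoeff q t u i.rev) * O (z ∘ adj i.rev) * f u (spec0div q t d) := by
      by_cases hu : u i.rev.castSucc = u i.rev.succ
      · rw [hβ.1 hu, heckeCoeff_of_eq hg hu]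
        ring
      · have h4 : (fun j => (spec q t (u ∘ adj i.rev) j)⁻¹) = z ∘ adj i.rev := by
          rw [spec_comp_adj hu]
          rfl
        rw [hO, h4]
        linear_combination O (z ∘ adj i.rev) * h1
    have h5 : heckeCoeff q t u i.rev * (z i.rev.castSucc - z i.rev.succ) =
        -(t - 1) * z i.rev.succ := by
      have h6 := spec_ne_zero hg u i.rev.castSucc
      have h7 := spec_ne_zero hg u i.rev.succ
      have h8 := sub_ne_zero.2 (spec_adj_ne hg u i.rev)
      rw [heckeCoeff, hz]
      field_simp
      ring
    have h6 := hdd z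
    rw [hxs]
    refine mul_left_cancel₀ hne ?_
    simp only [Pi.smul_apply, smul_eq_mul, Pi.sub_apply]
    rw [mul_assoc _ _ (f u _), mul_inv_cancel_left₀ hne]
    change _ = (_ * (t * O (z ∘ adj i.rev) - _) - _) * _
    change _ = O z - O (z ∘ adj i.rev) at h6
    rw [hO u, h3] at h2
    linear_combination h2 + (x i.rev.castSucc - x i.rev.succ) * f u (spec0div q t d) *
      (h5 * h z - heckeCoeff q t u i.rev * h6)

end

section

/-! ### Quadrature and leading terms -/

variable {m : ℕ} {q t : ℂ}

theorem exists_quadrature {ι : Type*} [Fintype ι] {k : ℕ} (x : ι → Fin n → ℂ) (p : ι → Prop)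
    [DecidablePred p]
    (h : ∀ g ∈ Pol n k, (∀ i, p i → g (x i) = 0) → g = 0) (y : Fin n → ℂ) :
    ∃ c : ι → ℂ, ∀ g ∈ Pol n k, g y = ∑ i, if p i then c i * g (x i) else 0 := by
  let ev : (Fin n → ℂ) → Pol n k →ₗ[ℂ] ℂ := fun z =>
    (LinearMap.proj z : ((Fin n → ℂ) → ℂ) →ₗ[ℂ] ℂ).comp (Pol n k).subtype
  have h1 : ev y ∈ Submodule.span ℂ (Set.range fun i => if p i then ev (x i) else 0) := by
    refine mem_span_of_iInf_ker_le_ker fun g hgk => ?_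
    have h2 : (g : (Fin n → ℂ) → ℂ) = 0 := by
      refine h g g.2 fun i hi => ?_
      have h3 := (Submodule.mem_iInf _).1 hgk i
      rw [if_pos hi] at h3
      exact h3
    change (g : (Fin n → ℂ) → ℂ) y = 0
    rw [h2, Pi.zero_apply]
  obtain ⟨c, hc⟩ := (Submodule.mem_span_range_iff_exists_fun ℂ).1 h1
  refine ⟨c, fun g hgm => ?_⟩
  have h2 := LinearMap.congr_fun hc ⟨g, hgm⟩
  rw [LinearMap.sum_apply] at h2
  refine h2.symm.trans (Finset.sum_congr rfl fun i _ => ?_)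
  split_ifs <;> simp [ev]

theorem exists_leading_term {k : ℕ} {f : (Fin n → ℂ) → ℂ} (hf : f ∈ Pol n (k + 1)) :
    ∃ E : (Fin n → ℂ) → ℂ, ∀ d : ℂ, d ≠ 0 →
      (fun y => d ^ k * f (fun i => y i / d) - E y) ∈ Pol n k := by
  obtain ⟨p, hp, hpf⟩ := mem_Pol_succ.1 hf
  refine ⟨fun x => eval x (homogeneousComponent k p), fun d hd => ?_⟩
  have h1 := comp_mem_Pol (exists_top_component hp)
    (g := fun i (y : Fin n → ℂ) => d⁻¹ * y i) fun i => scale_mem_Pol d⁻¹ i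
  convert (Pol n k).smul_mem (d ^ k) h1 using 1
  funext y
  simp only [Pi.smul_apply, smul_eq_mul]
  rw [eval_mul_homogeneousComponent, mul_sub, ← mul_assoc, ← mul_pow, mul_inv_cancel₀ hd, one_pow,
    one_mul, hpf]
  simp only [div_eq_inv_mul]

/-! ### Matrices indexed by compositions of bounded weight -/

/-- Compositions of weight at most `N`. -/
abbrev Idx (m N : ℕ) := {v : Fin (m + 1) → ℕ // wt v ≤ N}

instance (m N : ℕ) : Finite (Idx m N) := by
  refine Set.Finite.subset (Set.finite_Iic fun _ : Fin (m + 1) => N) (t := {v | wt v ≤ N})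
    fun v hv i => ?_
  exact (Finset.single_le_sum (fun _ _ => Nat.zero_le _) (Finset.mem_univ i)).trans hv

instance (m N : ℕ) : Fintype (Idx m N) := Fintype.ofFinite _

variable {f : (Fin (m + 1) → ℕ) → (Fin (m + 1) → ℂ) → ℂ} {N : ℕ}

/-- The values of interpolation polynomials at rescaled dual spectral vectors. -/
def dualMatrix (q t : ℂ) (f : (Fin (m + 1) → ℕ) → (Fin (m + 1) → ℂ) → ℂ) (N : ℕ) (d : ℂ) :
    Matrix (Idx m N) (Idx m N) ℂ :=
  Matrix.of fun u w => f u.1 fun i => dualPt q t w.1 i / d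

theorem IsInterp.eq_zero_of_sum_eq_zero (hf : IsInterp q t f) {y : Idx m N → ℂ}
    (h : ∀ x, ∑ u, y u * f u.1 x = 0) : y = 0 := by
  have key : ∀ (k : ℕ) (u : Idx m N), wt u.1 = k → y u = 0 := by
    intro k
    induction k using Nat.strong_induction_on with
    | _ k ih =>
      intro u hu
      have h1 := h (spec q t u.1)
      rw [Finset.sum_eq_single_of_mem u (Finset.mem_univ u)] at h1
      · exact (mul_eq_zero.1 h1).resolve_right (hf u.1).2.1
      · intro v _ hvu
        rcases lt_or_ge (wt v.1) (wt u.1) with hlt | hge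
        · rw [ih _ (hu ▸ hlt) v rfl, zero_mul]
        · rw [(hf v.1).2.2 u.1 hge fun he => hvu (Subtype.ext he).symm, mul_zero]
  funext u
  exact key _ u rfl

theorem IsInterp.isUnit_dualMatrix (hg : Generic q t) (hf : IsInterp q t f) {d : ℂ} (hd : d ≠ 0) :
    IsUnit (dualMatrix q t f N d) := by
  rw [← Matrix.vecMul_injective_iff_isUnit, ← Matrix.coe_vecMulLinear,
    injective_iff_map_eq_zero]
  intro y hy
  refine hf.eq_zero_of_sum_eq_zero fun x => ?_
  have hm : ∑ u, y u • f u.1 ∈ Pol (m + 1) (N + 1) := (Pol _ _).sum_mem fun u _ =>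
    (Pol _ _).smul_mem _ (Pol_mono (by have := u.2; omega) (hf u.1).1)
  have h1 := eq_zero_of_vanishes_dualPt hg hm hd fun w hw => by
    have h2 := congrFun hy ⟨w, Nat.lt_succ_iff.1 hw⟩
    simpa [Matrix.vecMul, dotProduct, dualMatrix] using h2
  simpa using congrFun h1 x

theorem exists_annihilator (hg : Generic q t) (m N : ℕ) :
    ∃ L : Matrix (Idx m N) (Idx m N) ℂ, IsUnit L ∧ (∀ v, L v v = 1) ∧
      (∀ u v, u ≠ v → wt v.1 ≤ wt u.1 → L v u = 0) ∧
      ∀ v, ∀ g ∈ Pol (m + 1) (wt v.1), ∑ u, L v u * g (fun i => (spec q t u.1 i)⁻¹) = 0 := by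
  have h1 : ∀ v : Idx m N, ∃ c : Idx m N → ℂ, ∀ g ∈ Pol (m + 1) (wt v.1),
      g (fun i => (spec q t v.1 i)⁻¹) =
        ∑ u, if wt u.1 < wt v.1 then c u * g (fun i => (spec q t u.1 i)⁻¹) else 0 := fun v =>
    exists_quadrature (fun u : Idx m N => fun i => (spec q t u.1 i)⁻¹) _ (fun g hgm h0 =>
      eq_zero_of_vanishes_spec_inv hg hgm fun w hw =>
        h0 ⟨w, hw.le.trans v.2⟩ hw) _
  choose c hc using h1
  set L : Matrix (Idx m N) (Idx m N) ℂ := Matrix.of fun v u =>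
    (if u = v then 1 else 0) - if wt u.1 < wt v.1 then c v u else 0 with hL
  have hL1 : ∀ v, L v v = 1 := fun v => by simp [hL]
  have hL0 : ∀ u v, u ≠ v → wt v.1 ≤ wt u.1 → L v u = 0 := fun u v huv hle => by
    simp [hL, huv, hle]
  refine ⟨L, ?_, hL1, hL0, fun v g hgm => ?_⟩
  · rw [← Matrix.mulVec_injective_iff_isUnit, ← Matrix.coe_mulVecLin, injective_iff_map_eq_zero]
    intro y hy
    have key : ∀ (k : ℕ) (v : Idx m N), wt v.1 = k → y v = 0 := by
      intro k
      induction k using Nat.strong_induction_on with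
      | _ k ih =>
        intro v hv
        have h1 : ∑ u, L v u * y u = 0 := congrFun hy v
        rw [Finset.sum_eq_single_of_mem v (Finset.mem_univ v), hL1, one_mul] at h1
        · exact h1
        · intro u _ huv
          rcases lt_or_ge (wt u.1) (wt v.1) with hlt | hge
          · rw [ih _ (hv ▸ hlt) u rfl, mul_zero]
          · rw [hL0 u v huv hge, zero_mul]
    funext v
    exact key _ v rfl
  · simp only [hL, Matrix.of_apply, sub_mul, Finset.sum_sub_distrib, ite_mul, one_mul, zero_mul,
      Finset.sum_ite_eq', Finset.mem_univ, if_true, ← hc v g hgm, sub_self]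

theorem comp_div_mem_Pol {k : ℕ} {f : (Fin n → ℂ) → ℂ} (hf : f ∈ Pol n k) (d : ℂ) :
    (fun y : Fin n → ℂ => f fun i => y i / d) ∈ Pol n k := by
  simpa only [div_eq_inv_mul] using comp_mem_Pol hf fun i => scale_mem_Pol d⁻¹ i

/-- The scalar `d` is not a zero of any shifted factorial. -/
def Regular (m : ℕ) (q t d : ℂ) : Prop :=
  d ≠ 0 ∧ ∀ v : Fin (m + 1) → ℕ, qfac q t d v ≠ 0

theorem IsInterp.regular_independent (hg : Generic q t) (hf : IsInterp q t f)
    {c : (Fin (m + 1) → ℕ) → ℂ} (hc : ∀ u, c u ≠ 0)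
    (hcd : ∀ u d, d ≠ 0 → f u (spec0div q t d) = c u * (d ^ wt u)⁻¹ * qfac q t d u)
    {L : Matrix (Idx m N) (Idx m N) ℂ} (hL1 : ∀ v, L v v = 1)
    (hL0 : ∀ u v, u ≠ v → wt v.1 ≤ wt u.1 → L v u = 0)
    (hL : ∀ v, ∀ g ∈ Pol (m + 1) (wt v.1), ∑ u, L v u * g (fun i => (spec q t u.1 i)⁻¹) = 0)
    {d d' : ℂ} (hd : Regular m q t d) (hd' : Regular m q t d') (v w : Idx m N) :
    qfac q t d v.1 * ∑ u, L v u *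
      (f u.1 (fun i => dualPt q t w.1 i / d) / f u.1 (spec0div q t d)) =
    qfac q t d' v.1 * ∑ u, L v u *
      (f u.1 (fun i => dualPt q t w.1 i / d') / f u.1 (spec0div q t d')) := by
  set h : ℂ → (Fin (m + 1) → ℂ) → ℂ := fun d y => qfac q t d v.1 * ∑ u, L v u *
      (f u.1 (fun i => y i / d) / f u.1 (spec0div q t d)) with hh
  obtain ⟨E, hE⟩ := exists_leading_term (hf v.1).1
  have hev : ∀ {d : ℂ}, Regular m q t d → ∀ u, f u (spec0div q t d) ≠ 0 := fun {d} hd u => by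
    rw [hcd u d hd.1]
    exact mul_ne_zero (mul_ne_zero (hc u) (inv_ne_zero (pow_ne_zero _ hd.1))) (hd.2 u)
  have hmem : ∀ d, Regular m q t d →
      (fun y => h d y - (c v.1)⁻¹ * E y) ∈ Pol (m + 1) (wt v.1) := by
    intro d hd
    have h1 : (fun y => ∑ u, if u = v then 0 else
        L v u * (f u.1 (spec0div q t d))⁻¹ * f u.1 fun i => y i / d) ∈ Pol (m + 1) (wt v.1) := by
      have : ∀ u : Idx m N, (fun y : Fin (m + 1) → ℂ => if u = v then 0 else
          L v u * (f u.1 (spec0div q t d))⁻¹ * f u.1 fun i => y i / d) ∈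
            Pol (m + 1) (wt v.1) := by
        intro u
        by_cases huv : u = v
        · simp only [if_pos huv]
          exact (Pol (m + 1) (wt v.1)).zero_mem
        · simp only [if_neg huv]
          rcases lt_or_ge (wt u.1) (wt v.1) with hlt | hge
          · exact (Pol _ _).smul_mem _ (Pol_mono hlt (comp_div_mem_Pol (hf u.1).1 d))
          · simp only [hL0 u v huv hge, zero_mul]
            exact (Pol (m + 1) (wt v.1)).zero_mem
      convert (Pol (m + 1) (wt v.1)).sum_mem fun u (_ : u ∈ Finset.univ) => this u using 1
      funext y
      simp
    convert (Pol _ _).add_mem ((Pol _ _).smul_mem (c v.1)⁻¹ (hE d hd.1))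
      ((Pol _ _).smul_mem (qfac q t d v.1) h1) using 1
    funext y
    have h2 : ∑ u, L v u * (f u.1 (fun i => y i / d) / f u.1 (spec0div q t d)) =
        f v.1 (fun i => y i / d) / f v.1 (spec0div q t d) + ∑ u, if u = v then 0 else
          L v u * (f u.1 (spec0div q t d))⁻¹ * f u.1 fun i => y i / d := by
      trans ∑ u, ((if u = v then f v.1 (fun i => y i / d) / f v.1 (spec0div q t d) else 0) +
        if u = v then 0 else L v u * (f u.1 (spec0div q t d))⁻¹ * f u.1 fun i => y i / d)
      · refine Finset.sum_congr rfl fun u _ => ?_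
        split_ifs with huv
        · rw [huv, hL1, one_mul, add_zero]
        · rw [zero_add]
          ring
      · rw [Finset.sum_add_distrib, Finset.sum_ite_eq' Finset.univ v, if_pos (Finset.mem_univ v)]
    simp only [hh, h2, Pi.add_apply, Pi.smul_apply, smul_eq_mul, hcd v.1 d hd.1]
    have h3 := hc v.1
    have h4 := hd.2 v.1
    have h5 := hd.1
    field_simp
    ring
  have hzero : (fun y => h d y - h d' y) = 0 := by
    refine eq_zero_of_vanishes_dualPt hg (k := wt v.1) (d := 1) ?_ one_ne_zero fun w hw => ?_
    · convert (Pol _ _).sub_mem (hmem d hd) (hmem d' hd') using 1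
      funext y
      simp
    · have hvan : ∀ d, Regular m q t d → h d (dualPt q t w) = 0 := fun d hd => by
        obtain ⟨O, hO, hO'⟩ := hf.exists_dual hg hd.1 hd.2 w
        have h1 := hL v O (Pol_mono hw hO)
        simp only [hh, hO', mul_div_assoc, div_self (hev hd _), mul_one, h1, mul_zero]
      simp only [div_one]
      change h d (dualPt q t w) - h d' (dualPt q t w) = 0
      rw [hvan d hd, hvan d' hd', sub_zero]
  exact sub_eq_zero.1 (congrFun hzero (dualPt q t w.1))

end

section

/-! ### Bailey-type factorization of the dual matrices -/

variable {m N : ℕ} {q t : ℂ} {f : (Fin (m + 1) → ℕ) → (Fin (m + 1) → ℂ) → ℂ}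

theorem dense_regular (hg : Generic q t) (m : ℕ) : Dense {d : ℂ | Regular m q t d} := by
  have h1 : ({0} ∪ Set.range fun p : ℕ × ℕ => t ^ p.1 / q ^ p.2 : Set ℂ).Countable :=
    (Set.countable_singleton 0).union (Set.countable_range _)
  refine (h1.dense_compl ℝ).mono fun d hd => ?_
  simp only [Set.mem_compl_iff, Set.mem_union, Set.mem_singleton_iff, Set.mem_range,
    not_or, not_exists] at hd
  refine ⟨hd.1, fun v => Finset.prod_ne_zero_iff.2 fun i _ => Finset.prod_ne_zero_iff.2
    fun j _ h0 => hd.2 (lp v i, j) ?_⟩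
  have hq := pow_ne_zero j hg.1
  have ht := pow_ne_zero (lp v i) hg.2.1
  field_simp at h0 ⊢
  linear_combination h0

/-- The diagonal matrix with entries `g v`. -/
def diagHom (m N : ℕ) : ((Fin (m + 1) → ℕ) → ℂ) →* Matrix (Idx m N) (Idx m N) ℂ where
  toFun g := Matrix.diagonal fun v => g v.1
  map_one' := by ext; simp [Matrix.diagonal, Matrix.one_apply]
  map_mul' g h := by simp [Matrix.diagonal_mul_diagonal]

theorem isUnit_diagHom {g : (Fin (m + 1) → ℕ) → ℂ} (hgv : ∀ v, g v ≠ 0) :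
    IsUnit (diagHom m N g) :=
  (Pi.isUnit_iff.2 fun v => (hgv v).isUnit).map (diagHom m N)

/-- The dual matrix with its rows normalized by leading behaviour. -/
def rowMatrix (q t : ℂ) (f : (Fin (m + 1) → ℕ) → (Fin (m + 1) → ℂ) → ℂ)
    (c : (Fin (m + 1) → ℕ) → ℂ) (N : ℕ) (b : ℂ) : Matrix (Idx m N) (Idx m N) ℂ :=
  diagHom m N (fun u => b ^ wt u / c u) * dualMatrix q t f N b

theorem IsInterp.isUnit_rowMatrix (hg : Generic q t) (hf : IsInterp q t f)
    {c : (Fin (m + 1) → ℕ) → ℂ} (hc : ∀ u, c u ≠ 0) {b : ℂ} (hb : b ≠ 0) :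
    IsUnit (rowMatrix q t f c N b) :=
  (isUnit_diagHom fun u => div_ne_zero (pow_ne_zero _ hb) (hc u)).mul
    (hf.isUnit_dualMatrix hg hb)

theorem IsInterp.exists_continuous_rowMatrix (hf : IsInterp q t f)
    (c : (Fin (m + 1) → ℕ) → ℂ) (N : ℕ) :
    ∃ W : ℂ → Matrix (Idx m N) (Idx m N) ℂ, Continuous W ∧
      ∀ b, b ≠ 0 → W b = b • rowMatrix q t f c N b := by
  choose r hr _ hrb using fun u w : Idx m N =>
    exists_continuous_reverse (hf u.1).1 (dualPt q t w.1)
  refine ⟨fun b => Matrix.of fun u w => (c u.1)⁻¹ * r u w b,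
    continuous_matrix fun u w => continuous_const.mul (hr u w), fun b hb => ?_⟩
  ext u w
  simp only [Matrix.of_apply, ← hrb u w b hb, rowMatrix, diagHom, MonoidHom.coe_mk, OneHom.coe_mk,
    Matrix.smul_apply, Matrix.diagonal_mul, dualMatrix, smul_eq_mul]
  ring

theorem IsInterp.exists_factorization (hg : Generic q t) (hf : IsInterp q t f)
    {c : (Fin (m + 1) → ℕ) → ℂ} (hc : ∀ u, c u ≠ 0)
    (hcd : ∀ u d, d ≠ 0 → f u (spec0div q t d) = c u * (d ^ wt u)⁻¹ * qfac q t d u)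
    {d : ℂ} (hd : Regular m q t d) (N : ℕ) :
    ∃ V B : Matrix (Idx m N) (Idx m N) ℂ, IsUnit V ∧ IsUnit B ∧ ∀ b, b ≠ 0 →
      rowMatrix q t f c N b * V * diagHom m N (qfac q t b) = diagHom m N (qfac q t b) * B := by
  obtain ⟨L, hLu, hL1, hL0, hL⟩ := exists_annihilator hg m N
  set D : ℂ → Matrix (Idx m N) (Idx m N) ℂ := fun b => diagHom m N (qfac q t b) with hD
  set D' : ℂ → Matrix (Idx m N) (Idx m N) ℂ := fun b => diagHom m N (qfac q t b)⁻¹ with hD'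
  set U : Matrix (Idx m N) (Idx m N) ℂ := D d * L * D' d * rowMatrix q t f c N d with hU
  have hDD' : ∀ b, Regular m q t b → D b * D' b = 1 := fun b hb => by
    have h1 : qfac q t b * (qfac q t b)⁻¹ = 1 := funext fun v => mul_inv_cancel₀ (hb.2 v)
    rw [← map_one (diagHom m N), ← h1, map_mul]
  have hentry : ∀ b, Regular m q t b → ∀ v w,
      (D b * L * D' b * rowMatrix q t f c N b) v w = qfac q t b v.1 * ∑ u, L v u *
        (f u.1 (fun i => dualPt q t w.1 i / b) / f u.1 (spec0div q t b)) := by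
    intro b hb v w
    rw [mul_assoc, mul_assoc]
    simp only [hD, hD', rowMatrix, diagHom, MonoidHom.coe_mk, OneHom.coe_mk, Matrix.diagonal_mul]
    rw [Matrix.mul_apply]
    congr 1
    refine Finset.sum_congr rfl fun u _ => ?_
    rw [Matrix.diagonal_mul, Matrix.diagonal_mul, hcd u.1 b hb.1]
    have h1 := hc u.1
    have h2 := hb.2 u.1
    have h3 := hb.1
    simp only [dualMatrix, Matrix.of_apply, Pi.inv_apply]
    field_simp
  have hUb : ∀ b, Regular m q t b → D b * L * D' b * rowMatrix q t f c N b = U := by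
    intro b hb
    ext v w
    rw [hU, hentry b hb, hentry d hd, hf.regular_independent hg hc hcd hL1 hL0 hL hb hd]
  have hUu : IsUnit U := (((isUnit_diagHom hd.2).mul hLu).mul
    (isUnit_diagHom fun v => inv_ne_zero (hd.2 v))).mul (hf.isUnit_rowMatrix hg hc hd.1)
  obtain ⟨Z, hZ⟩ := hUu
  obtain ⟨L, rfl⟩ := hLu
  set V : Matrix (Idx m N) (Idx m N) ℂ := ↑Z⁻¹ with hV
  set B : Matrix (Idx m N) (Idx m N) ℂ := ↑L⁻¹ with hB
  have hBL : B * L = 1 := L.inv_mul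
  have hUV : U * V = 1 := by rw [← hZ, hV, Units.mul_inv]
  refine ⟨V, B, Z⁻¹.isUnit, L⁻¹.isUnit, ?_⟩
  obtain ⟨W, hW, hWb⟩ := hf.exists_continuous_rowMatrix c N
  have hDc : Continuous D := continuous_matrix fun u w => by
    simp only [hD, diagHom, MonoidHom.coe_mk, OneHom.coe_mk, Matrix.diagonal_apply]
    split_ifs
    · exact continuous_qfac _
    · exact continuous_const
  have key : (fun b => W b * V * D b) = fun b => b • (D b * B) := by
    refine Continuous.ext_on (dense_regular hg m) ((hW.mul continuous_const).mul hDc)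
      (continuous_id.smul (hDc.mul continuous_const)) fun b hb => ?_
    have h1 : D b * L * D' b * rowMatrix q t f c N b * V = 1 := by
      rw [hUb b hb, hUV]
    have h2 : D' b * D b = 1 := mul_eq_one_comm.1 (hDD' b hb)
    have h3 : rowMatrix q t f c N b * V = D b * B * D' b := by
      calc _ = D b * B * (D' b * D b) * L * D' b * rowMatrix q t f c N b * V := by
            rw [h2, mul_one, mul_assoc (D b), hBL, mul_one, hDD' b hb, one_mul]
        _ = D b * B * D' b * (D b * L * D' b * rowMatrix q t f c N b * V) := by
            simp only [mul_assoc]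
        _ = _ := by rw [h1, mul_one]
    simp only [hWb b hb.1, smul_mul_assoc, h3]
    rw [mul_assoc _ (D' b), h2, mul_one]
  intro b hb
  have h1 := congrFun key b
  simp only [hWb b hb, smul_mul_assoc] at h1
  exact smul_right_injective _ hb h1

theorem IsInterp.exists_scale_rowMatrix (hg : Generic q t) (hf : IsInterp q t f)
    (c : (Fin (m + 1) → ℕ) → ℂ) (N : ℕ) {μ : ℂ} (hμ : μ ≠ 0) :
    ∃ R : Matrix (Idx m N) (Idx m N) ℂ, ∀ d, d ≠ 0 →
      rowMatrix q t f c N (μ * d) * R =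
        diagHom m N (fun u => μ ^ wt u) * rowMatrix q t f c N d := by
  have h1 := fun w : Idx m N => exists_quadrature (k := N + 1)
    (fun v : Idx m N => fun i => dualPt q t v.1 i / μ) (fun _ => True) (fun g hgm h0 =>
      eq_zero_of_vanishes_dualPt hg hgm hμ fun w hw =>
        h0 ⟨w, Nat.lt_succ_iff.1 hw⟩ trivial) (dualPt q t w.1)
  choose r hr using h1
  refine ⟨Matrix.of fun v w => r w v, fun d hd => ?_⟩
  ext u w
  have h2 := hr w _ (comp_div_mem_Pol (Pol_mono (Nat.succ_le_succ u.2) (hf u.1).1) d)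
  simp only [rowMatrix, diagHom, MonoidHom.coe_mk, OneHom.coe_mk]
  rw [Matrix.mul_assoc, ← Matrix.mul_assoc (Matrix.diagonal _) (Matrix.diagonal _),
    Matrix.diagonal_mul_diagonal, Matrix.diagonal_mul, Matrix.diagonal_mul, Matrix.mul_apply]
  simp only [dualMatrix, Matrix.of_apply]
  rw [h2, mul_pow, mul_div_assoc]
  congr 1
  refine Finset.sum_congr rfl fun v _ => ?_
  simp only [if_true, div_div]
  rw [mul_comm]

end

section

/-! ### Skew coefficients -/

variable {m N : ℕ} {q t : ℂ} {f : (Fin (m + 1) → ℕ) → (Fin (m + 1) → ℂ) → ℂ}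
  {M : (Fin (m + 1) → ℕ) → MvPolynomial (Fin (m + 1)) ℂ} {c : (Fin (m + 1) → ℕ) → ℂ}

theorem finsum_eq_sum_idx {E : Type*} [AddCommMonoid E] (F : (Fin (m + 1) → ℕ) → E)
    (h : ∀ v, N < wt v → F v = 0) : ∑ᶠ v, F v = ∑ v : Idx m N, F v.1 := by
  rw [← finsum_eq_sum_of_fintype, finsum_subtype_eq_finsum_cond (f := F) fun v => wt v ≤ N]
  refine finsum_congr fun v => ?_
  by_cases hv : wt v ≤ N
  · simp [hv]
  · simp [hv, h v (not_le.1 hv)]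

theorem Generic.cp_ne_zero (hg : Generic q t) (u : Fin n → ℕ) : cp q t u ≠ 0 :=
  Finset.prod_ne_zero_iff.2 fun i _ => Finset.prod_ne_zero_iff.2 fun j hj =>
    sub_ne_zero.2 (hg.pow_ne_one (Or.inl (by have := Finset.mem_range.1 hj; omega))).symm

theorem eval_top_component {k : ℕ} {p : MvPolynomial (Fin n) ℂ} (hp : p.totalDegree ≤ k)
    {r : ℂ → ℂ} (hr : Continuous r) {x : Fin n → ℂ}
    (h : ∀ d, d ≠ 0 → eval (fun i => x i / d) p = (d ^ k)⁻¹ * r d) :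
    eval x (homogeneousComponent k p) = r 0 := by
  obtain ⟨s, hs, hs0, hsd⟩ := exists_continuous_reverse (exists_top_component hp) x
  have key : (fun d => eval x (homogeneousComponent k p) + s d) = r := by
    refine Continuous.ext_on (dense_compl_singleton (0 : ℂ)) (continuous_const.add hs) hr
      fun d (hd : d ≠ 0) => ?_
    have h1 := eval_mul_homogeneousComponent k p d⁻¹ x
    simp only [← div_eq_inv_mul] at h1
    simp only [← hsd d hd, h1, h d hd, inv_pow]
    have := pow_ne_zero k hd
    field_simp
    ring
  simpa only [hs0, add_zero] using congrFun key 0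

theorem eval_EE (hM : IsInterpFamily q t M)
    (hcd : ∀ u d, d ≠ 0 →
      eval (spec0div q t d) (M u) = c u * (d ^ wt u)⁻¹ * qfac q t d u)
    {a : ℂ} (u : Fin (m + 1) → ℕ) :
    eval (spec0div q t a) (EE q t M u) = t ^ nstat u / cp q t u * ((a ^ wt u)⁻¹ * c u) := by
  have h1 : eval (spec q t fun _ => 0) (homogeneousComponent (wt u) (M u)) = c u := by
    have h2 := eval_top_component (hM u).1 (r := fun d => c u * qfac q t d u)
      (continuous_const.mul (continuous_qfac u)) (x := spec q t fun _ => 0) fun d hd => by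
        have h3 := hcd u d hd
        unfold spec0div at h3
        rw [h3]
        ring
    rw [h2]
    simp [qfac]
  have h2 := eval_mul_homogeneousComponent (wt u) (M u) a⁻¹ (spec q t fun _ => 0)
  rw [h1, inv_pow] at h2
  rw [EE, map_mul, eval_C, ← h2]
  simp only [← div_eq_inv_mul]
  rfl

theorem IsConnection.eval_eq {a b : ℂ} {cc : (Fin (m + 1) → ℕ) → (Fin (m + 1) → ℕ) → ℂ}
    (h : IsConnection q t M a b cc) (u : Idx m N) (x : Fin (m + 1) → ℂ) :
    eval (fun i => a * x i) (MM q t M u.1) =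
      ∑ v : Idx m N, cc u.1 v.1 * eval (fun i => b * x i) (MM q t M v.1) := by
  have hev : ∀ (z : ℂ) (p : MvPolynomial (Fin (m + 1)) ℂ),
      eval x (aeval (fun i => C z * X i) p) = eval (fun i => z * x i) p := fun z p => by
    induction p using MvPolynomial.induction_on with
    | C a => simp
    | add p r hp hr => simp only [map_add, hp, hr]
    | mul_X p i hp => simp only [map_mul, hp, aeval_X, eval_C, eval_X]
  have h1 := congrArg (eval x) (h.2 u.1)
  rw [finsum_eq_sum_idx (N := N) _ fun v hv => by rw [h.1 _ _ (u.2.trans_lt hv), zero_smul],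
    hev, map_sum] at h1
  simpa only [smul_eval, hev] using h1

/-- The matrix of skew coefficients. -/
def skewMatrix (q t : ℂ) (M : (Fin (m + 1) → ℕ) → MvPolynomial (Fin (m + 1)) ℂ) (N : ℕ)
    (a b : ℂ) (cc : (Fin (m + 1) → ℕ) → (Fin (m + 1) → ℕ) → ℂ) :
    Matrix (Idx m N) (Idx m N) ℂ :=
  Matrix.of fun u v => skew q t M a b cc u.1 v.1

theorem skewMatrix_mul (hg : Generic q t) (hM : IsInterpFamily q t M) (hc : ∀ u, c u ≠ 0)
    (hcd : ∀ u d, d ≠ 0 →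
      eval (spec0div q t d) (M u) = c u * (d ^ wt u)⁻¹ * qfac q t d u)
    {a b : ℂ} (ha : a ≠ 0) (hb : b ≠ 0) {cc : (Fin (m + 1) → ℕ) → (Fin (m + 1) → ℕ) → ℂ}
    (h : IsConnection q t M a b cc) :
    skewMatrix q t M N a b cc * (diagHom m N (fun u => q ^ nstat' u) *
      rowMatrix q t (fun u x => eval x (M u)) c N a) =
    diagHom m N (fun u => q ^ nstat' u) * rowMatrix q t (fun u x => eval x (M u)) c N b := by
  ext u w
  have h1 := h.eval_eq u fun i => dualPt q t w.1 i / (a * b)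
  have h2 : ∀ x : ℂ, a * (x / (a * b)) = x / b := fun x => by field_simp
  have h3 : ∀ x : ℂ, b * (x / (a * b)) = x / a := fun x => by field_simp
  simp only [h2, h3, MM, map_mul, eval_C] at h1
  simp only [rowMatrix, diagHom, MonoidHom.coe_mk, OneHom.coe_mk]
  rw [Matrix.mul_apply]
  simp only [Matrix.diagonal_mul, skewMatrix, dualMatrix, Matrix.of_apply, skew, eval_EE hM hcd]
  have hq := hg.1
  have ht := hg.2.1
  have h4 := hg.cp_ne_zero u.1
  have h5 := hc u.1
  have h6 : eval (fun i => dualPt q t w.1 i / b) (M u.1) =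
      cp q t u.1 / (q ^ nstat' u.1 * t ^ nstat u.1) *
        (q ^ nstat' u.1 * t ^ nstat u.1 / cp q t u.1 *
          eval (fun i => dualPt q t w.1 i / b) (M u.1)) := by
    field_simp
  rw [h6, h1, Finset.mul_sum, Finset.mul_sum, Finset.mul_sum]
  refine Finset.sum_congr rfl fun v _ => ?_
  have h7 := hg.cp_ne_zero v.1
  have h8 := hc v.1
  field_simp

theorem exists_skew_factorization (hg : Generic q t) (hM : IsInterpFamily q t M) {d : ℂ}
    (hd : Regular m q t d) (N : ℕ) :
    ∃ (Y : ℂ → Matrix (Idx m N) (Idx m N) ℂ) (B : Matrix (Idx m N) (Idx m N) ℂ),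
      IsUnit B ∧ (∀ b, b ≠ 0 → IsUnit (Y b)) ∧
      (∀ b, b ≠ 0 → Y b * diagHom m N (qfac q t b) = diagHom m N (qfac q t b) * B) ∧
      (∀ μ, μ ≠ 0 → ∃ R, ∀ b, b ≠ 0 → Y (μ * b) * R = diagHom m N (fun u => μ ^ wt u) * Y b) ∧
      ∀ a b cc, a ≠ 0 → b ≠ 0 → IsConnection q t M a b cc →
        skewMatrix q t M N a b cc * Y a = Y b := by
  have hf := hM.isInterp hg
  choose c hc hcd using fun u => hf.eval_spec0div hg u
  obtain ⟨V, B, hV, hB, hVB⟩ := hf.exists_factorization hg hc hcd hd N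
  set K := diagHom m N fun u => q ^ nstat' u with hK
  have hKu : IsUnit K := isUnit_diagHom fun u => pow_ne_zero _ hg.1
  have hKc : ∀ g, K * diagHom m N g = diagHom m N g * K := fun g => by
    rw [hK, ← map_mul, mul_comm, map_mul]
  refine ⟨fun b => K * rowMatrix q t (fun u x => eval x (M u)) c N b * V, K * B, hKu.mul hB,
    fun b hb => (hKu.mul (hf.isUnit_rowMatrix hg hc hb)).mul hV, fun b hb => ?_,
    fun μ hμ => ?_, fun a b cc ha hb h => ?_⟩
  · beta_reduce
    rw [mul_assoc K, mul_assoc K, hVB b hb, ← mul_assoc, hKc, mul_assoc]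
  · obtain ⟨R, hR⟩ := hf.exists_scale_rowMatrix hg c N hμ
    obtain ⟨Z, rfl⟩ := hV
    refine ⟨((Z⁻¹ : (Matrix (Idx m N) (Idx m N) ℂ)ˣ) : Matrix (Idx m N) (Idx m N) ℂ) * R *
      (Z : Matrix (Idx m N) (Idx m N) ℂ), fun b hb => ?_⟩
    simp only [mul_assoc, Units.mul_inv_cancel_left]
    rw [← mul_assoc (rowMatrix _ _ _ _ _ _) R, hR b hb, ← mul_assoc K, ← mul_assoc K, hKc]
    simp only [mul_assoc]
  · rw [← mul_assoc, skewMatrix_mul hg hM hc hcd ha hb h]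

/-! ### The transformation -/

theorem conj_product_eq {G A : Type*} [Monoid G] [CommMonoid A] (φ : A →* G)
    {B Yc Yd Ye Yf Yg Yh : Gˣ} {f g h δ κ : Aˣ} {c d e : A} {S T R : G}
    (hS : S * (φ ↑δ⁻¹ * Ye) = φ ↑δ⁻¹ * Yh) (hT : T * (φ κ * Yc) = φ κ * Yf)
    (hR : Yg * R = φ (κ * δ) * Yd) (hc : Yc * φ c = φ c * B) (hd : Yd * φ d = φ d * B)
    (he : Ye * φ e = φ e * B) (hf : Yf * φ f = φ f * B) (hg : Yg * φ g = φ g * B)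
    (hh : Yh * φ h = φ h * B) :
    φ (f * g) * S * φ (d * e * ↑f⁻¹ * ↑g⁻¹) * T * φ c =
      φ (f * g * h * ↑δ⁻¹) * B * φ (e * ↑h⁻¹ * ↑g⁻¹) * R * φ (d * c * ↑f⁻¹) * ↑B⁻¹ * φ ↑κ⁻¹ := by
  have hi : ∀ x : Aˣ, φ x * φ ↑x⁻¹ = 1 := fun x => by rw [← map_mul, Units.mul_inv, map_one]
  have hi' : ∀ x : Aˣ, φ ↑x⁻¹ * φ x = 1 := fun x => by rw [← map_mul, Units.inv_mul, map_one]
  have hS' : S = φ ↑δ⁻¹ * Yh * ↑Ye⁻¹ * φ δ := by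
    rw [← hS]; simp only [mul_assoc, Units.mul_inv_cancel_left, hi', mul_one]
  have hT' : T = φ κ * Yf * ↑Yc⁻¹ * φ ↑κ⁻¹ := by
    rw [← hT]; simp only [mul_assoc, Units.mul_inv_cancel_left, hi, mul_one]
  have hR' : R = ↑Yg⁻¹ * φ (κ * δ) * Yd := by
    rw [mul_assoc, ← hR, Units.inv_mul_cancel_left]
  have flip : ∀ {Y : Gˣ} {x : A}, Y * φ x = φ x * B → ↑Y⁻¹ * φ x = φ x * ↑B⁻¹ := by
    intro Y x hx
    rw [← Units.mul_right_inj Y, Units.mul_inv_cancel_left, ← mul_assoc, hx,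
      Units.mul_inv_cancel_right]
  have hf' : φ ↑f⁻¹ * Yf = B * φ ↑f⁻¹ := by
    rw [← mul_one (Yf : G), ← hi f, ← mul_assoc (Yf : G), hf]
    simp only [← mul_assoc, hi', one_mul]
  have hh' : (Yh : G) = φ h * B * φ ↑h⁻¹ := by
    rw [← hh, mul_assoc, hi, mul_one]
  have hg' : (↑Yg⁻¹ : G) = φ g * ↑B⁻¹ * φ ↑g⁻¹ := by
    rw [← flip hg, mul_assoc, hi, mul_one]
  calc _ = φ (f * g) * φ ↑δ⁻¹ * Yh * ↑Ye⁻¹ * (φ δ * φ (d * e * ↑f⁻¹ * ↑g⁻¹) * φ κ) * Yf * ↑Yc⁻¹ *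
        (φ ↑κ⁻¹ * φ c) := by rw [hS', hT']; simp only [mul_assoc]
    _ = φ (f * g * ↑δ⁻¹) * Yh * ↑Ye⁻¹ * (φ e * φ (↑g⁻¹ * (κ * δ) * d) * φ ↑f⁻¹) * Yf * ↑Yc⁻¹ *
        (φ c * φ ↑κ⁻¹) := by
      have h1 : (δ * (d * e * ↑f⁻¹ * ↑g⁻¹) * κ : A) = e * (↑g⁻¹ * (κ * δ) * d) * ↑f⁻¹ := by ac_rfl
      simp only [← map_mul]
      rw [h1, mul_comm (↑κ⁻¹ : A) c]
    _ = φ (f * g * ↑δ⁻¹) * Yh * (↑Ye⁻¹ * φ e) * φ (↑g⁻¹ * (κ * δ) * d) * (φ ↑f⁻¹ * Yf) *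
        (↑Yc⁻¹ * φ c) * φ ↑κ⁻¹ := by simp only [mul_assoc]
    _ = (φ (f * g * ↑δ⁻¹) * φ h) * B * (φ ↑h⁻¹ * φ e) * ↑B⁻¹ * φ (↑g⁻¹ * (κ * δ) * d) * B *
        (φ ↑f⁻¹ * φ c) * ↑B⁻¹ * φ ↑κ⁻¹ := by
      rw [flip he, flip hc, hf', hh']; simp only [mul_assoc]
    _ = φ (f * g * h * ↑δ⁻¹) * B * (φ (e * ↑h⁻¹ * ↑g⁻¹) * φ g) * ↑B⁻¹ * φ ↑g⁻¹ * φ (κ * δ) *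
        (φ d * B) * φ (c * ↑f⁻¹) * ↑B⁻¹ * φ ↑κ⁻¹ := by
      have h1 : φ (f * g * ↑δ⁻¹) * φ h = φ (f * g * h * ↑δ⁻¹) := by
        rw [← map_mul]; congr 1; ac_rfl
      have h2 : φ ↑h⁻¹ * φ e = φ (e * ↑h⁻¹ * ↑g⁻¹) * φ g := by
        rw [← map_mul, ← map_mul, mul_assoc _ _ (g : A), Units.inv_mul, mul_one, mul_comm]
      have h3 : φ ↑f⁻¹ * φ c = φ (c * ↑f⁻¹) := by rw [← map_mul, mul_comm]
      have h4 : φ (↑g⁻¹ * (κ * δ) * d) = φ ↑g⁻¹ * φ (κ * δ) * φ d := by simp only [map_mul]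
      rw [h1, h2, h3, h4]
      simp only [mul_assoc]
    _ = _ := by
      rw [hR', hg', ← hd, mul_assoc d, map_mul φ d _]
      simp only [mul_assoc]

end

section

theorem exists_units_of_ne_zero {ι : Type*} {g : ι → ℂ} (hg : ∀ v, g v ≠ 0) :
    ∃ U : (ι → ℂ)ˣ, (U : ι → ℂ) = g ∧ ((U⁻¹ : (ι → ℂ)ˣ) : ι → ℂ) = g⁻¹ :=
  ⟨⟨g, g⁻¹, funext fun v => mul_inv_cancel₀ (hg v), funext fun v => inv_mul_cancel₀ (hg v)⟩,
    rfl, rfl⟩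

theorem skew_eq_zero {q t : ℂ} {M : (Fin n → ℕ) → MvPolynomial (Fin n) ℂ} {a b : ℂ}
    {cc : (Fin n → ℕ) → (Fin n → ℕ) → ℂ} (h : IsConnection q t M a b cc) {u v : Fin n → ℕ}
    (huv : wt u < wt v) : skew q t M a b cc u v = 0 := by
  rw [skew, h.1 u v huv, mul_zero]

variable {m N : ℕ} {q t : ℂ} {M : (Fin (m + 1) → ℕ) → MvPolynomial (Fin (m + 1)) ℂ}
  {cc cc' : (Fin (m + 1) → ℕ) → (Fin (m + 1) → ℕ) → ℂ}

theorem finsum_skew_eq {x y z : ℂ} {f g c d e : ℂ} (h : IsConnection q t M x y cc)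
    {u w : Fin (m + 1) → ℕ} (hwu : wt w ≤ wt u) (hc : qfac q t c w ≠ 0) :
    ∑ᶠ v, qfac q t f u * qfac q t g u * qfac q t d v * qfac q t e v /
        (qfac q t f v * qfac q t g v * qfac q t d w * qfac q t e w) *
        skew q t M x y cc u v * skew q t M y z cc' v w =
      (qfac q t c w * qfac q t d w * qfac q t e w)⁻¹ *
        (diagHom m (wt u) (qfac q t f * qfac q t g) * skewMatrix q t M (wt u) x y cc *
          diagHom m (wt u) (qfac q t d * qfac q t e * (qfac q t f)⁻¹ * (qfac q t g)⁻¹) *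
          skewMatrix q t M (wt u) y z cc' * diagHom m (wt u) (qfac q t c))
        ⟨u, le_rfl⟩ ⟨w, hwu⟩ := by
  rw [finsum_eq_sum_idx (N := wt u) _ fun v hv => by
    rw [skew_eq_zero h hv, mul_zero, zero_mul]]
  simp only [diagHom, MonoidHom.coe_mk, OneHom.coe_mk]
  rw [Matrix.mul_diagonal, Matrix.mul_apply, Finset.sum_mul, Finset.mul_sum]
  refine Finset.sum_congr rfl fun v _ => ?_
  simp only [Matrix.mul_diagonal, Matrix.diagonal_mul, skewMatrix, Matrix.of_apply, Pi.mul_apply,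
    Pi.inv_apply, mul_inv, div_eq_mul_inv]
  rw [← mul_one (_ * (skew q t M y z cc' v.1 w)), ← mul_inv_cancel₀ hc]
  ring

theorem skewMatrix_product_eq (hgen : Generic q t) (hM : IsInterpFamily q t M)
    {c d e f k : ℂ} (hc : c ≠ 0) (hd : d ≠ 0) (he : e ≠ 0) (hk : k ≠ 0)
    (hf : Regular m q t f) (hg : Regular m q t (k * e * d)) (hh : Regular m q t (k * e * c))
    {cc₁ cc₂ cc₃ cc₄ : (Fin (m + 1) → ℕ) → (Fin (m + 1) → ℕ) → ℂ}
    (h1 : IsConnection q t M 1 (k * c) cc₁) (h2 : IsConnection q t M (k * c) (k * f) cc₂)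
    (h3 : IsConnection q t M 1 (k * d) cc₃) (h4 : IsConnection q t M (k * d) (k * f) cc₄) (N : ℕ) :
    diagHom m N (qfac q t f * qfac q t (k * e * d)) * skewMatrix q t M N 1 (k * c) cc₁ *
        diagHom m N (qfac q t d * qfac q t e * (qfac q t f)⁻¹ * (qfac q t (k * e * d))⁻¹) *
        skewMatrix q t M N (k * c) (k * f) cc₂ * diagHom m N (qfac q t c) =
      diagHom m N (qfac q t f * qfac q t (k * e * c)) * skewMatrix q t M N 1 (k * d) cc₃ *
        diagHom m N (qfac q t c * qfac q t e * (qfac q t f)⁻¹ * (qfac q t (k * e * c))⁻¹) *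
        skewMatrix q t M N (k * d) (k * f) cc₄ * diagHom m N (qfac q t d) := by
  obtain ⟨Y, B, hB, hY, hYB, hscale, hskew⟩ := exists_skew_factorization hgen hM hf N
  have hconj : ∀ {S : Matrix (Idx m N) (Idx m N) ℂ} {z x y x' y' : ℂ}, z ≠ 0 → x ≠ 0 →
      y ≠ 0 → S * Y x' = Y y' → z * x = x' → z * y = y' →
      S * (diagHom m N (fun v => z ^ wt v) * Y x) = diagHom m N (fun v => z ^ wt v) * Y y := by
    intro S z x y x' y' hz hx hy hS hx' hy'
    obtain ⟨R, hR⟩ := hscale z hz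
    rw [← hR x hx, ← hR y hy, ← mul_assoc, hx', hS, hy']
  have hkc := mul_ne_zero hk hc
  have hkd := mul_ne_zero hk hd
  have hkf := mul_ne_zero hk hf.1
  have he' := inv_ne_zero he
  have e1 := hconj he' he hh.1 (hskew 1 _ cc₁ one_ne_zero hkc h1) (inv_mul_cancel₀ he)
    (by field_simp)
  have e2 := hconj hk hc hf.1 (hskew _ _ cc₂ hkc hkf h2) rfl rfl
  have e3 := hconj he' he hg.1 (hskew 1 _ cc₃ one_ne_zero hkd h3) (inv_mul_cancel₀ he)
    (by field_simp)
  have e4 := hconj hk hd hf.1 (hskew _ _ cc₄ hkd hkf h4) rfl rfl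
  obtain ⟨R, hR⟩ := hscale (k * e) (mul_ne_zero hk he)
  have hRd := hR d hd
  have hRc := hR c hc
  have hBc := hYB c hc
  have hBd := hYB d hd
  have hBe := hYB e he
  have hBf := hYB f hf.1
  have hBg := hYB _ hg.1
  have hBh := hYB _ hh.1
  obtain ⟨Yc, hYc⟩ := hY c hc
  obtain ⟨Yd, hYd⟩ := hY d hd
  obtain ⟨Ye, hYe⟩ := hY e he
  obtain ⟨Yf, hYf⟩ := hY f hf.1
  obtain ⟨Yg, hYg⟩ := hY _ hg.1
  obtain ⟨Yh, hYh⟩ := hY _ hh.1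
  obtain ⟨B, rfl⟩ := hB
  obtain ⟨F, hF, hF'⟩ := exists_units_of_ne_zero hf.2
  obtain ⟨G, hG, hG'⟩ := exists_units_of_ne_zero hg.2
  obtain ⟨H, hH, hH'⟩ := exists_units_of_ne_zero hh.2
  obtain ⟨Δ, hΔ, hΔ'⟩ := exists_units_of_ne_zero
    fun v : Fin (m + 1) → ℕ => pow_ne_zero (wt v) he
  obtain ⟨K, hK, -⟩ := exists_units_of_ne_zero
    fun v : Fin (m + 1) → ℕ => pow_ne_zero (wt v) hk
  have hΔi : (fun v => e⁻¹ ^ wt v) = (↑Δ⁻¹ : (Fin (m + 1) → ℕ) → ℂ) := by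
    rw [hΔ']
    funext v
    simp
  have hKΔ : (fun v => (k * e) ^ wt v) = (K * Δ : (Fin (m + 1) → ℕ) → ℂ) := by
    rw [hK, hΔ]
    funext v
    rw [Pi.mul_apply, ← mul_pow]
  rw [hΔi, ← hYe, ← hYh] at e1
  rw [hΔi, ← hYe, ← hYg] at e3
  rw [← hK, ← hYc, ← hYf] at e2
  rw [← hK, ← hYd, ← hYf] at e4
  rw [hKΔ, ← hYd, ← hYg] at hRd
  rw [hKΔ, ← hYc, ← hYh] at hRc
  rw [← hYc] at hBc
  rw [← hYd] at hBd
  rw [← hYe] at hBe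
  rw [← hYf, ← hF] at hBf
  rw [← hYg, ← hG] at hBg
  rw [← hYh, ← hH] at hBh
  rw [← hF', ← hG', ← hH', ← hF, ← hG, ← hH,
    conj_product_eq (diagHom m N) e1 e2 hRd hBc hBd hBe hBf hBg hBh,
    conj_product_eq (diagHom m N) e3 e4 hRc hBd hBc hBe hBf hBh hBg,
    mul_right_comm (F : (Fin (m + 1) → ℕ) → ℂ), mul_comm (qfac q t d),
    mul_right_comm (qfac q t e)]

end

/-- **Multiple Sears transformation** (Proposition 6.8). -/
theorem multiple_sears_transformation
    (hn : 0 < n) (q t : ℂ) (hq0 : q ≠ 0) (ht : t ≠ 0)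
    (hqt : ∀ i j : ℤ, ¬(i = 0 ∧ j = 0) → q ^ i * t ^ j ≠ 1)
    (M : (Fin n → ℕ) → MvPolynomial (Fin n) ℂ) (hM : IsInterpFamily q t M)
    (a b c d e : ℂ) (ha : a ≠ 0) (hb : b ≠ 0) (hc : c ≠ 0) (hd : d ≠ 0) (he : e ≠ 0)
    (u w : Fin n → ℕ)
    (hbv : ∀ v : Fin n → ℕ, qfac q t (a * q / b) v ≠ 0)
    (hcv : ∀ v : Fin n → ℕ, qfac q t (a * q / c) v ≠ 0)
    (hdv : ∀ v : Fin n → ℕ, qfac q t (a * q / d) v ≠ 0)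
    (hdw : qfac q t d w ≠ 0) (hew : qfac q t e w ≠ 0) (hcw : qfac q t c w ≠ 0)
    (cc₁ cc₂ cc₃ cc₄ : (Fin n → ℕ) → (Fin n → ℕ) → ℂ)
    (h1 : IsConnection q t M 1 (a * q / (d * e)) cc₁)
    (h2 : IsConnection q t M (a * q / (d * e)) (a ^ 2 * q ^ 2 / (b * c * d * e)) cc₂)
    (h3 : IsConnection q t M 1 (a * q / (c * e)) cc₃)
    (h4 : IsConnection q t M (a * q / (c * e)) (a ^ 2 * q ^ 2 / (b * c * d * e)) cc₄) :
    ∑ᶠ v : Fin n → ℕ,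
        qfac q t (a * q / b) u * qfac q t (a * q / c) u * qfac q t d v * qfac q t e v /
          (qfac q t (a * q / b) v * qfac q t (a * q / c) v * qfac q t d w * qfac q t e w) *
        skew q t M 1 (a * q / (d * e)) cc₁ u v *
        skew q t M (a * q / (d * e)) (a ^ 2 * q ^ 2 / (b * c * d * e)) cc₂ v w =
      ∑ᶠ v : Fin n → ℕ,
        qfac q t (a * q / b) u * qfac q t (a * q / d) u * qfac q t c v * qfac q t e v /
          (qfac q t (a * q / b) v * qfac q t (a * q / d) v * qfac q t c w * qfac q t e w) *
        skew q t M 1 (a * q / (c * e)) cc₃ u v *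
        skew q t M (a * q / (c * e)) (a ^ 2 * q ^ 2 / (b * c * d * e)) cc₄ v w := by
  have hgen : Generic q t := ⟨hq0, ht, hqt⟩
  obtain ⟨m, rfl⟩ : ∃ m, n = m + 1 := ⟨n - 1, by omega⟩
  rcases lt_or_ge (wt u) (wt w) with huw | hwu
  · have hzero : ∀ {x y z : ℂ} {cc cc'} (_ : IsConnection q t M x y cc)
        (_ : IsConnection q t M y z cc') (g : (Fin (m + 1) → ℕ) → ℂ),
        ∑ᶠ v, g v * skew q t M x y cc u v * skew q t M y z cc' v w = 0 := by
      intro x y z cc cc' h h' g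
      refine finsum_eq_zero_of_forall_eq_zero fun v => ?_
      rcases lt_or_ge (wt u) (wt v) with huv | hvu
      · rw [skew_eq_zero h huv, mul_zero, zero_mul]
      · rw [skew_eq_zero h' (hvu.trans_lt huw), mul_zero]
    rw [hzero h1 h2, hzero h3 h4]
  have key := skewMatrix_product_eq hgen hM (m := m) (f := a * q / b)
    (k := a * q / (c * d * e)) hc hd he
    (div_ne_zero (mul_ne_zero ha hq0) (mul_ne_zero (mul_ne_zero hc hd) he))
    (cc₁ := cc₁) (cc₂ := cc₂) (cc₃ := cc₃) (cc₄ := cc₄) (N := wt u)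
  have hg : a * q / (c * d * e) * e * d = a * q / c := by field_simp
  have hh : a * q / (c * d * e) * e * c = a * q / d := by field_simp
  have hx : a * q / (c * d * e) * c = a * q / (d * e) := by field_simp
  have hy : a * q / (c * d * e) * d = a * q / (c * e) := by field_simp
  have hz : a * q / (c * d * e) * (a * q / b) = a ^ 2 * q ^ 2 / (b * c * d * e) := by field_simp
  rw [hg, hh, hx, hy, hz] at key
  have hreg : ∀ z, z ≠ 0 → (∀ v, qfac q t (a * q / z) v ≠ 0) → Regular m q t (a * q / z) :=
    fun z hz hv => ⟨div_ne_zero (mul_ne_zero ha hq0) hz, hv⟩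
  replace key := key (hreg b hb hbv) (hreg c hc hcv) (hreg d hd hdv) h1 h2 h3 h4
  have e1 := finsum_skew_eq (d := d) (e := e) (f := a * q / b) (g := a * q / c) (cc' := cc₂)
    (z := a ^ 2 * q ^ 2 / (b * c * d * e)) h1 hwu hcw
  have e2 := finsum_skew_eq (d := c) (e := e) (f := a * q / b) (g := a * q / d) (cc' := cc₄)
    (z := a ^ 2 * q ^ 2 / (b * c * d * e)) h3 hwu hdw
  refine e1.trans (Eq.trans ?_ e2.symm)
  rw [key, mul_comm (qfac q t c w)]

end LRW
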